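/- arXiv:1705.06024 — 12 statements merged into one kernel-verified Lean document; each statement's English description precedes it below -/
import Mathlib

section
/- Let V be a finite vertex set, p a demand distribution on V, and Δ ≥ 1 a natural number. Then for every connected simple graph N on V with maximum degree at most Δ, the expected path length satisfies EPL(p, N) ≥ H(Y∣X)/log₂(Δ+1) − 1 and EPL(p, N) ≥ H(X∣Y)/log₂(Δ+1) − 1; in particular EPL(p, N) ≥ max(H(Y∣X), H(X∣Y))/log₂(Δ+1) − 1. -/
open Finset SimpleGraph Real

attribute [local instance] Classical.propDecidable

/-- Expected path length of demand `p` on host graph `N`. -/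
noncomputable def EPL {V : Type} [Fintype V] (p : V → V → ℝ) (N : SimpleGraph V) : ℝ :=
  ∑ u, ∑ v, p u v * (N.dist u v : ℝ)

/-- Base-2 conditional entropy `H(Y|X)` of the demand distribution `p`. -/
noncomputable def condHYX {V : Type} [Fintype V] (p : V → V → ℝ) : ℝ :=
  ∑ u, ∑ v, if 0 < p u v then p u v * Real.logb 2 ((∑ w, p u w) / p u v) else 0

/-- Base-2 conditional entropy `H(X|Y)` of the demand distribution `p`. -/
noncomputable def condHXY {V : Type} [Fintype V] (p : V → V → ℝ) : ℝ :=
  ∑ u, ∑ v, if 0 < p u v then p u v * Real.logb 2 ((∑ w, p w v) / p u v) else 0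

theorem SimpleGraph.card_dist_eq_le_pow {V : Type*} [Fintype V] {N : SimpleGraph V}
    [DecidableRel N.Adj] (hconn : N.Connected) {Δ : ℕ} (hdeg : ∀ v, N.degree v ≤ Δ)
    (u : V) (k : ℕ) : #{v | N.dist u v = k} ≤ Δ ^ k := by
  induction k with
  | zero =>
    rw [pow_zero, Finset.card_le_one]
    intro a ha b hb
    simp only [Finset.mem_filter, Finset.mem_univ, true_and, hconn.dist_eq_zero_iff] at ha hb
    exact ha.symm.trans hb
  | succ k ih =>
    have hsub : ({v | N.dist u v = k + 1} : Finset V) ⊆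
        ({v | N.dist u v = k} : Finset V).biUnion fun w => N.neighborFinset w := by
      intro v hv
      simp only [Finset.mem_filter, Finset.mem_univ, true_and] at hv
      obtain ⟨c, hc⟩ := hconn.exists_walk_length_eq_dist v u
      rw [dist_comm, hv] at hc
      cases c with
      | nil => simp at hc
      | @cons _ w _ h c =>
        simp only [Walk.length_cons, Nat.add_right_cancel_iff] at hc
        simp only [Finset.mem_biUnion, Finset.mem_filter, Finset.mem_univ, true_and,
          mem_neighborFinset]
        refine ⟨w, ?_, h.symm⟩
        have h1 : N.dist u w ≤ k := by rw [dist_comm, ← hc]; exact dist_le c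
        have h2 := hconn.dist_triangle (u := u) (v := w) (w := v)
        rw [hv, dist_eq_one_iff_adj.2 h.symm] at h2
        omega
    calc _ ≤ _ := Finset.card_le_card hsub
      _ ≤ #{v | N.dist u v = k} * Δ :=
        Finset.card_biUnion_le_card_mul _ _ _ fun w _ => by
          rw [card_neighborFinset_eq_degree]; exact hdeg w
      _ ≤ Δ ^ (k + 1) := by rw [pow_succ]; exact Nat.mul_le_mul_right _ ih

theorem SimpleGraph.sum_inv_pow_dist_le_one {V : Type*} [Fintype V] {N : SimpleGraph V}
    [DecidableRel N.Adj] (hconn : N.Connected) {Δ : ℕ} (hdeg : ∀ v, N.degree v ≤ Δ) (u : V) :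
    ∑ v, (((Δ : ℝ) + 1) ^ (N.dist u v + 1))⁻¹ ≤ 1 := by
  have hpos : (0 : ℝ) < (Δ : ℝ) + 1 := by positivity
  obtain ⟨n, hn⟩ : ∃ n, ∀ v, N.dist u v < n :=
    ⟨(Finset.univ.sup fun v => N.dist u v) + 1, fun v =>
      Nat.lt_succ_of_le (Finset.le_sup (f := fun v => N.dist u v) (Finset.mem_univ v))⟩
  have hgeom : ∀ m : ℕ, ∑ k ∈ Finset.range m, (Δ : ℝ) ^ k * (((Δ : ℝ) + 1) ^ (k + 1))⁻¹
      = 1 - (Δ : ℝ) ^ m * (((Δ : ℝ) + 1) ^ m)⁻¹ := by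
    intro m
    induction m with
    | zero => simp
    | succ m ih => rw [Finset.sum_range_succ, ih]; field_simp; ring
  calc ∑ v, (((Δ : ℝ) + 1) ^ (N.dist u v + 1))⁻¹
      = ∑ k ∈ Finset.range n, ∑ v with N.dist u v = k, (((Δ : ℝ) + 1) ^ (N.dist u v + 1))⁻¹ :=
        (Finset.sum_fiberwise_of_maps_to (fun v _ => Finset.mem_range.2 (hn v)) _).symm
    _ ≤ ∑ k ∈ Finset.range n, (Δ : ℝ) ^ k * (((Δ : ℝ) + 1) ^ (k + 1))⁻¹ := by
        refine Finset.sum_le_sum fun k _ => ?_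
        rw [Finset.sum_congr rfl (g := fun _ => (((Δ : ℝ) + 1) ^ (k + 1))⁻¹)
          fun v hv => by rw [(Finset.mem_filter.1 hv).2], Finset.sum_const, nsmul_eq_mul]
        gcongr
        exact_mod_cast card_dist_eq_le_pow hconn hdeg u k
    _ ≤ 1 := by
        rw [hgeom]
        have : 0 ≤ (Δ : ℝ) ^ n * (((Δ : ℝ) + 1) ^ n)⁻¹ := by positivity
        linarith

/-- Gibbs' inequality for nonnegative weights `q` against a subprobability weight `r`. -/
theorem sum_mul_logb_div_le {V : Type*} [Fintype V] {q r : V → ℝ} (hq : ∀ v, 0 ≤ q v)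
    (hr : ∀ v, 0 < r v) (hr1 : ∑ v, r v ≤ 1) :
    ∑ v, (if 0 < q v then q v * Real.logb 2 ((∑ w, q w) / q v) else 0)
      ≤ ∑ v, q v * Real.logb 2 (r v)⁻¹ := by
  have hP : 0 ≤ ∑ w, q w := Finset.sum_nonneg fun w _ => hq w
  have hlog2 : 0 < Real.log 2 := Real.log_pos one_lt_two
  have hterm : ∀ v, (if 0 < q v then q v * Real.logb 2 ((∑ w, q w) / q v) else 0)
      ≤ q v * Real.logb 2 (r v)⁻¹ + (r v * (∑ w, q w) - q v) / Real.log 2 := by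
    intro v
    split_ifs with h
    · have hPv : 0 < ∑ w, q w :=
        h.trans_le (Finset.single_le_sum (fun w _ => hq w) (Finset.mem_univ v))
      have hrv := hr v
      have hx : Real.log (r v * (∑ w, q w) / q v) ≤ r v * (∑ w, q w) / q v - 1 :=
        Real.log_le_sub_one_of_pos (by positivity)
      rw [mul_div_assoc, Real.log_mul hrv.ne' (by positivity)] at hx
      have hmul := mul_le_mul_of_nonneg_left hx h.le
      have hcancel : q v * (r v * ((∑ w, q w) / q v) - 1) = r v * (∑ w, q w) - q v := by
        field_simp
      rw [hcancel] at hmul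
      rw [Real.logb, Real.logb, Real.log_inv, mul_div_assoc', mul_div_assoc', ← add_div]
      gcongr
      linarith
    · have h0 : q v = 0 := le_antisymm (not_lt.1 h) (hq v)
      rw [h0]
      have := (hr v).le
      simp only [zero_mul, zero_add, sub_zero]
      positivity
  refine (Finset.sum_le_sum fun v _ => hterm v).trans ?_
  rw [Finset.sum_add_distrib, ← Finset.sum_div, Finset.sum_sub_distrib, ← Finset.sum_mul]
  have : ((∑ v, r v) * (∑ w, q w) - ∑ w, q w) / Real.log 2 ≤ 0 :=
    div_nonpos_of_nonpos_of_nonneg (by nlinarith) hlog2.le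
  linarith

/-- The conditional entropy given the source is at most `log₂ (Δ + 1)` times one plus the
expected path length. -/
theorem condHYX_le_logb_mul_EPL_add_one {V : Type} [Fintype V] {p : V → V → ℝ}
    (hp0 : ∀ u v, 0 ≤ p u v) (hp1 : ∑ u, ∑ v, p u v = 1) {N : SimpleGraph V}
    [DecidableRel N.Adj] (hconn : N.Connected) {Δ : ℕ} (hdeg : ∀ v, N.degree v ≤ Δ) :
    condHYX p ≤ (EPL p N + 1) * Real.logb 2 ((Δ : ℝ) + 1) := by
  calc condHYX p
      ≤ ∑ u, ∑ v, p u v * Real.logb 2 ((((Δ : ℝ) + 1) ^ (N.dist u v + 1))⁻¹)⁻¹ :=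
        Finset.sum_le_sum fun u _ => sum_mul_logb_div_le (hp0 u) (fun v => by positivity)
          (sum_inv_pow_dist_le_one hconn hdeg u)
    _ = (EPL p N + 1) * Real.logb 2 ((Δ : ℝ) + 1) := by
        rw [EPL, ← hp1]
        simp only [← Finset.sum_add_distrib, Finset.sum_mul, inv_inv, Real.logb_pow]
        refine Finset.sum_congr rfl fun u _ => Finset.sum_congr rfl fun v _ => ?_
        push_cast
        ring

theorem EPL_swap {V : Type} [Fintype V] (p : V → V → ℝ) (N : SimpleGraph V) :
    EPL (fun u v => p v u) N = EPL p N := by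
  unfold EPL
  rw [Finset.sum_comm]
  simp only [dist_comm]

theorem condHYX_swap {V : Type} [Fintype V] (p : V → V → ℝ) :
    condHYX (fun u v => p v u) = condHXY p :=
  Finset.sum_comm

theorem stmt_0 {V : Type} [Fintype V] [DecidableEq V]
    (p : V → V → ℝ) (hp0 : ∀ u v, 0 ≤ p u v) (hpdiag : ∀ u, p u u = 0)
    (hp1 : ∑ u, ∑ v, p u v = 1)
    (Δ : ℕ) (hΔ : 1 ≤ Δ)
    (N : SimpleGraph V) (hconn : N.Connected) (hdeg : N.maxDegree ≤ Δ) :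
    EPL p N ≥ condHYX p / Real.logb 2 ((Δ : ℝ) + 1) - 1 ∧
    EPL p N ≥ condHXY p / Real.logb 2 ((Δ : ℝ) + 1) - 1 ∧
    EPL p N ≥ max (condHYX p) (condHXY p) / Real.logb 2 ((Δ : ℝ) + 1) - 1 := by
  have hL : 0 < Real.logb 2 ((Δ : ℝ) + 1) :=
    Real.logb_pos one_lt_two (by have : (1 : ℝ) ≤ Δ := by exact_mod_cast hΔ
                                 linarith)
  have hdeg' : ∀ v, N.degree v ≤ Δ := fun v => (N.degree_le_maxDegree v).trans hdeg
  have hYX := condHYX_le_logb_mul_EPL_add_one hp0 hp1 hconn hdeg'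
  have hXY := condHYX_le_logb_mul_EPL_add_one (p := fun u v => p v u) (fun u v => hp0 v u)
    (by rw [Finset.sum_comm]; exact hp1) hconn hdeg'
  rw [condHYX_swap, EPL_swap] at hXY
  simp only [ge_iff_le, sub_le_iff_le_add, div_le_iff₀ hL]
  exact ⟨hYX, hXY, max_le hYX hXY⟩
end

section
/- Let V be a finite vertex set, q a probability vector on V, Δ ≥ 1 a natural number, and (T, r) a Δ-ary rooted tree on V. Then the expected depth satisfies ∑_{v ∈ V} q v · d_T(r, v) ≥ H(q)/log₂(Δ+1) − 1. -/
open Finset SimpleGraph Real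

attribute [local instance] Classical.propDecidable

/-- In a connected graph, every vertex other than `r` has a neighbour one step closer to `r`. -/
theorem SimpleGraph.Connected.exists_adj_dist_add_one {V : Type*} {G : SimpleGraph V}
    (hG : G.Connected) {r v : V} (hv : v ≠ r) :
    ∃ u, G.Adj u v ∧ G.dist r v = G.dist r u + 1 := by
  obtain ⟨p, hp⟩ := hG.exists_walk_length_eq_dist v r
  cases p with
  | nil => exact absurd rfl hv
  | @cons _ u _ h p =>
    refine ⟨u, h.symm, ?_⟩
    have h₁ : G.dist u r ≤ p.length := dist_le p
    have h₂ : G.dist v r ≤ G.dist v u + G.dist u r := hG.dist_triangle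
    rw [dist_eq_one_iff_adj.mpr h] at h₂
    rw [Walk.length_cons] at hp
    rw [dist_comm, dist_comm (u := r) (v := u)]
    omega

/-- In a connected rooted graph of `Δ`-ary degrees, every vertex has at most `Δ` neighbours
further from the root. -/
theorem card_children_le {V : Type} [Fintype V] {G : SimpleGraph V} (hG : G.Connected)
    {Δ : ℕ} {r : V} (hroot : G.degree r ≤ Δ) (hdeg : ∀ v, v ≠ r → G.degree v ≤ Δ + 1) (u : V) :
    #{v | G.Adj u v ∧ G.dist r v = G.dist r u + 1} ≤ Δ := by
  have hsub : ({v | G.Adj u v ∧ G.dist r v = G.dist r u + 1} : Finset V) ⊆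
      G.neighborFinset u := fun v hv => by
    simpa using (mem_filter.mp hv).2.1
  rcases eq_or_ne u r with rfl | hu
  · exact (card_le_card hsub).trans hroot
  · obtain ⟨p, hp, hd⟩ := hG.exists_adj_dist_add_one hu
    have hlt := card_lt_card (hsub.ssubset_of_ne fun h => by
      have : p ∈ G.neighborFinset u := by simpa using hp.symm
      rw [← h, mem_filter] at this
      omega)
    rw [card_neighborFinset_eq_degree] at hlt
    exact Nat.le_of_lt_succ (hlt.trans_le (hdeg u hu))

/-- A Kraft inequality for the depths of all vertices of a `Δ`-ary rooted graph. -/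
theorem sum_inv_pow_depth_le_one {V : Type} [Fintype V] {G : SimpleGraph V} (hG : G.Connected)
    {Δ : ℕ} {r : V} (hroot : G.degree r ≤ Δ) (hdeg : ∀ v, v ≠ r → G.degree v ≤ Δ + 1) :
    ∑ v, (((Δ : ℝ) + 1) ^ (G.dist r v + 1))⁻¹ ≤ 1 := by
  set w : V → ℝ := fun v => (((Δ : ℝ) + 1) ^ (G.dist r v + 1))⁻¹ with hw
  have hpos : (0 : ℝ) < Δ + 1 := by positivity
  have hw0 : ∀ v, 0 ≤ w v := fun v => by positivity
  have hstep : ∑ v ∈ univ.erase r, w v ≤ ∑ u, Δ * (w u / (Δ + 1)) := by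
    calc ∑ v ∈ univ.erase r, w v
        ≤ ∑ v, ∑ u, if G.Adj u v ∧ G.dist r v = G.dist r u + 1 then w v else 0 := by
          refine (sum_le_sum fun v hv => ?_).trans (sum_le_sum_of_subset_of_nonneg
            (subset_univ _) fun v _ _ => sum_nonneg fun u _ => ?_)
          · obtain ⟨u, hu⟩ := hG.exists_adj_dist_add_one (ne_of_mem_erase hv)
            refine le_trans (if_pos hu).ge (single_le_sum (f := fun u =>
              if G.Adj u v ∧ G.dist r v = G.dist r u + 1 then w v else 0)
              (fun u _ => ?_) (mem_univ u))
            split_ifs <;> simp [hw0]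
          · split_ifs <;> simp [hw0]
      _ = ∑ u, ∑ v, if G.Adj u v ∧ G.dist r v = G.dist r u + 1 then w v else 0 := sum_comm
      _ ≤ ∑ u, Δ * (w u / (Δ + 1)) := by
          refine sum_le_sum fun u _ => ?_
          rw [← sum_filter, sum_congr rfl (g := fun _ => w u / (Δ + 1)), sum_const, nsmul_eq_mul]
          · have := card_children_le hG hroot hdeg u
            have := hw0 u
            gcongr
          · intro v hv
            simp only [hw, (mem_filter.mp hv).2.2]
            rw [pow_succ _ (G.dist r u + 1), mul_inv, div_eq_mul_inv]
  have hr : w r = 1 / (Δ + 1) := by simp [hw]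
  rw [← mul_sum, ← sum_div] at hstep
  have hsum := add_sum_erase univ w (mem_univ r)
  rw [hr] at hsum
  have hle : ∑ v, w v ≤ 1 / (Δ + 1) + Δ * ((∑ v, w v) / (Δ + 1)) := by linarith
  have heq : 1 / ((Δ : ℝ) + 1) + Δ * ((∑ v, w v) / (Δ + 1)) =
      (1 + Δ * ∑ v, w v) / (Δ + 1) := by ring
  rw [heq, le_div_iff₀ hpos] at hle
  linarith

/-- Gibbs' inequality, for a subprobability vector `w` with positive entries. -/
theorem entropy_le_cross_entropy {V : Type*} [Fintype V] {q w : V → ℝ}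
    (hq0 : ∀ v, 0 ≤ q v) (hq1 : ∑ v, q v = 1) (hw0 : ∀ v, 0 < w v) (hw1 : ∑ v, w v ≤ 1) :
    (∑ v, if 0 < q v then q v * logb 2 (1 / q v) else 0) ≤ ∑ v, q v * logb 2 (1 / w v) := by
  have hlog : 0 < log 2 := log_pos one_lt_two
  have hterm : ∀ v, (if 0 < q v then q v * logb 2 (1 / q v) else 0) ≤
      q v * logb 2 (1 / w v) + (w v - q v) / log 2 := by
    intro v
    have hw := hw0 v
    split_ifs with hq
    · have h := mul_le_mul_of_nonneg_left (log_le_sub_one_of_pos (div_pos hw hq)) hq.le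
      rw [mul_sub, mul_div_cancel₀ _ hq.ne', mul_one, log_div hw.ne' hq.ne'] at h
      rw [logb, logb, one_div, one_div, log_inv, log_inv, mul_div_assoc', mul_div_assoc',
        ← add_div]
      gcongr
      linarith
    · have hq' : q v = 0 := le_antisymm (not_lt.mp hq) (hq0 v)
      rw [hq', zero_mul, zero_add, sub_zero]
      positivity
  calc _ ≤ ∑ v, (q v * logb 2 (1 / w v) + (w v - q v) / log 2) := sum_le_sum fun v _ => hterm v
    _ = ∑ v, q v * logb 2 (1 / w v) + (∑ v, w v - 1) / log 2 := by
      rw [sum_add_distrib, ← sum_div, sum_sub_distrib, hq1]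
    _ ≤ _ := by
      have : (∑ v, w v - 1) / log 2 ≤ 0 := div_nonpos_of_nonpos_of_nonneg (by linarith) hlog.le
      linarith

theorem stmt_1 {V : Type} [Fintype V] [DecidableEq V]
    (q : V → ℝ) (hq0 : ∀ v, 0 ≤ q v) (hq1 : ∑ v, q v = 1)
    (Δ : ℕ) (hΔ : 1 ≤ Δ)
    (T : SimpleGraph V) (hT : T.IsTree) (r : V)
    (hroot : T.degree r ≤ Δ) (hdeg : ∀ v, v ≠ r → T.degree v ≤ Δ + 1) :
    ∑ v, q v * (T.dist r v : ℝ) ≥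
      (∑ v, if 0 < q v then q v * Real.logb 2 (1 / q v) else 0) /
        Real.logb 2 ((Δ : ℝ) + 1) - 1 := by
  have hΔ' : (1 : ℝ) ≤ Δ := by exact_mod_cast hΔ
  have hL : 0 < logb 2 ((Δ : ℝ) + 1) := logb_pos one_lt_two (by linarith)
  have hG := entropy_le_cross_entropy hq0 hq1 (fun v => by positivity)
    (sum_inv_pow_depth_le_one hT.connected hroot hdeg)
  have hcross : ∑ v, q v * logb 2 (1 / (((Δ : ℝ) + 1) ^ (T.dist r v + 1))⁻¹) =
      (∑ v, q v * (T.dist r v : ℝ) + 1) * logb 2 ((Δ : ℝ) + 1) := by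
    have hone : ∑ v, q v * (T.dist r v : ℝ) + 1 = ∑ v, (q v * (T.dist r v : ℝ) + q v) := by
      rw [sum_add_distrib, hq1]
    rw [hone, sum_mul]
    refine sum_congr rfl fun v _ => ?_
    rw [one_div, inv_inv, logb_pow]
    push_cast
    ring
  rw [hcross] at hG
  have := (div_le_iff₀ hL).mpr hG
  linarith
end

section
/- Let V be a finite vertex set, q a probability vector on V, Δ ≥ 1 a natural number, N a connected simple graph on V with maximum degree at most Δ, and u ∈ V. Then ∑_{v ∈ V} q v · d_N(u, v) ≥ H(q)/log₂(Δ+1) − 1. -/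
open Finset SimpleGraph Real

attribute [local instance] Classical.propDecidable

/-- A vertex at distance `n + 1` from `u` has a neighbour at distance `n` from `u`. -/
theorem SimpleGraph.Connected.exists_adj_dist_eq {V : Type*} {G : SimpleGraph V}
    (hG : G.Connected) {u v : V} {n : ℕ} (h : G.dist u v = n + 1) :
    ∃ w, G.Adj w v ∧ G.dist u w = n := by
  obtain ⟨p, hp⟩ := hG.exists_walk_length_eq_dist v u
  rw [SimpleGraph.dist_comm, h] at hp
  cases p with
  | nil => simp at hp
  | @cons _ w _ hadj p =>
    refine ⟨w, hadj.symm, ?_⟩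
    have hlen : p.length = n := by simpa using hp
    have hle : G.dist w u ≤ n := hlen ▸ SimpleGraph.dist_le p
    have htri := hG.dist_triangle (u := u) (v := w) (w := v)
    rw [SimpleGraph.dist_eq_one_iff_adj.mpr hadj.symm, h] at htri
    rw [SimpleGraph.dist_comm] at hle
    omega

/-- In a connected graph of maximum degree at most `Δ`, spheres of radius `n` have at most
`Δ ^ n` vertices. -/
theorem SimpleGraph.Connected.card_sphere_le {V : Type*} [Fintype V]
    {G : SimpleGraph V} (hG : G.Connected) {Δ : ℕ} (hdeg : G.maxDegree ≤ Δ) (u : V) (n : ℕ) :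
    #{v | G.dist u v = n} ≤ Δ ^ n := by
  induction n with
  | zero =>
    refine Finset.card_le_one.mpr fun a ha b hb => ?_
    simp only [Finset.mem_filter, Finset.mem_univ, true_and, hG.dist_eq_zero_iff] at ha hb
    exact ha.symm.trans hb
  | succ n ih =>
    calc #{v | G.dist u v = n + 1}
        ≤ #(({v | G.dist u v = n} : Finset V).biUnion fun w => G.neighborFinset w) := by
          refine Finset.card_le_card fun v hv => ?_
          obtain ⟨w, hadj, hw⟩ := hG.exists_adj_dist_eq (Finset.mem_filter.mp hv).2
          exact Finset.mem_biUnion.mpr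
            ⟨w, by simpa using hw, (G.mem_neighborFinset w v).mpr hadj⟩
      _ ≤ #{v | G.dist u v = n} * Δ :=
          Finset.card_biUnion_le_card_mul _ _ _ fun w _ => (G.degree_le_maxDegree w).trans hdeg
      _ ≤ Δ ^ (n + 1) := by
          rw [pow_succ]
          exact Nat.mul_le_mul_right _ ih

theorem sum_range_pow_div_succ_pow_le_one (Δ M : ℕ) :
    ∑ n ∈ Finset.range M, (Δ : ℝ) ^ n / ((Δ : ℝ) + 1) ^ (n + 1) ≤ 1 := by
  have hsum : ∑ n ∈ Finset.range M, (Δ : ℝ) ^ n / ((Δ : ℝ) + 1) ^ (n + 1) =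
      1 - (Δ : ℝ) ^ M / ((Δ : ℝ) + 1) ^ M := by
    induction M with
    | zero => simp
    | succ M ih =>
      rw [Finset.sum_range_succ, ih]
      have : (Δ : ℝ) + 1 ≠ 0 := by positivity
      field_simp
      ring
  rw [hsum]
  have : 0 ≤ (Δ : ℝ) ^ M / ((Δ : ℝ) + 1) ^ M := by positivity
  linarith

/-- A Kraft-type inequality for distances in a connected graph of bounded degree. -/
theorem SimpleGraph.Connected.sum_inv_pow_dist_succ_le_one {V : Type*} [Fintype V]
    {G : SimpleGraph V} (hG : G.Connected) {Δ : ℕ} (hdeg : G.maxDegree ≤ Δ) (u : V) :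
    ∑ v, (((Δ : ℝ) + 1) ^ (G.dist u v + 1))⁻¹ ≤ 1 := by
  set M := Finset.univ.sup (G.dist u) + 1
  have hmaps : ∀ v ∈ (Finset.univ : Finset V), G.dist u v ∈ Finset.range M := fun v hv =>
    Finset.mem_range.mpr (Nat.lt_succ_of_le (Finset.le_sup (f := G.dist u) hv))
  rw [← Finset.sum_fiberwise_of_maps_to hmaps]
  refine le_trans (Finset.sum_le_sum fun n _ => ?_) (sum_range_pow_div_succ_pow_le_one Δ M)
  calc ∑ v with G.dist u v = n, (((Δ : ℝ) + 1) ^ (G.dist u v + 1))⁻¹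
      = ∑ v with G.dist u v = n, (((Δ : ℝ) + 1) ^ (n + 1))⁻¹ :=
        Finset.sum_congr rfl fun v hv => by rw [(Finset.mem_filter.mp hv).2]
    _ = (#{v | G.dist u v = n} : ℝ) / ((Δ : ℝ) + 1) ^ (n + 1) := by
        rw [Finset.sum_const, nsmul_eq_mul, div_eq_mul_inv]
    _ ≤ (Δ : ℝ) ^ n / ((Δ : ℝ) + 1) ^ (n + 1) := by
        gcongr
        exact_mod_cast hG.card_sphere_le hdeg u n

/-- The pointwise form of Gibbs' inequality. -/
theorem Real.mul_log_one_div_le {x w : ℝ} (hx : 0 < x) (hw : 0 < w) :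
    x * Real.log (1 / x) ≤ x * Real.log w⁻¹ + (w - x) := by
  have h := mul_le_mul_of_nonneg_left (Real.log_le_sub_one_of_pos (div_pos hw hx)) hx.le
  rw [Real.log_div hw.ne' hx.ne', mul_sub, mul_sub, mul_div_cancel₀ _ hx.ne'] at h
  rw [one_div, Real.log_inv, Real.log_inv]
  linarith

theorem stmt_2 {V : Type} [Fintype V] [DecidableEq V]
    (q : V → ℝ) (hq0 : ∀ v, 0 ≤ q v) (hq1 : ∑ v, q v = 1)
    (Δ : ℕ) (hΔ : 1 ≤ Δ)
    (N : SimpleGraph V) (hconn : N.Connected) (hdeg : N.maxDegree ≤ Δ) (u : V) :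
    ∑ v, q v * (N.dist u v : ℝ) ≥
      (∑ v, if 0 < q v then q v * Real.logb 2 (1 / q v) else 0) /
        Real.logb 2 ((Δ : ℝ) + 1) - 1 := by
  have hΔ' : (1 : ℝ) ≤ Δ := by exact_mod_cast hΔ
  set L := Real.log ((Δ : ℝ) + 1) with hLdef
  have hL : 0 < L := Real.log_pos (by linarith)
  have h2 : 0 < Real.log 2 := Real.log_pos one_lt_two
  have hrescale : (∑ v, if 0 < q v then q v * Real.logb 2 (1 / q v) else 0) =
      (∑ v, if 0 < q v then q v * Real.log (1 / q v) else 0) / Real.log 2 := by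
    rw [Finset.sum_div]
    refine Finset.sum_congr rfl fun v _ => ?_
    split_ifs
    · rw [Real.logb, mul_div_assoc]
    · simp
  have hterm : ∀ v, (if 0 < q v then q v * Real.log (1 / q v) else 0) ≤
      q v * (N.dist u v : ℝ) * L + q v * L +
        ((((Δ : ℝ) + 1) ^ (N.dist u v + 1))⁻¹ - q v) := by
    intro v
    have hw : 0 < (((Δ : ℝ) + 1) ^ (N.dist u v + 1))⁻¹ := by positivity
    split_ifs with hv
    · have h := Real.mul_log_one_div_le hv hw
      rw [inv_inv, Real.log_pow, ← hLdef] at h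
      push_cast at h
      linarith
    · rw [le_antisymm (not_lt.mp hv) (hq0 v)]
      simpa using hw.le
  have hsum := Finset.sum_le_sum fun v (_ : v ∈ Finset.univ) => hterm v
  rw [Finset.sum_add_distrib, Finset.sum_add_distrib, Finset.sum_sub_distrib,
    ← Finset.sum_mul, ← Finset.sum_mul, hq1] at hsum
  have hkraft := hconn.sum_inv_pow_dist_succ_le_one hdeg u
  rw [hrescale, Real.logb, ← hLdef, div_div_div_cancel_right₀ h2.ne', ge_iff_le,
    sub_le_iff_le_add, div_le_iff₀ hL]
  linarith
end

section
/- Let V be a finite nonempty vertex set, q a probability vector on V, and Δ ≥ 2 a natural number. Then there exists a simple graph T on Option V (with the extra vertex none playing the role of the root u) such that T is a tree, the degree of none in T equals 1, the maximum degree of T is at most Δ+1, and ∑_{v ∈ V} q v · d_T(none, some v) ≤ H(q)/log₂ Δ + 2. -/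
/-- The graph joining every vertex other than the root `r` to its parent. -/
def parentGraph {W : Type*} (r : W) (par : W → W) : SimpleGraph W :=
  SimpleGraph.fromRel fun x y => x ≠ r ∧ par x = y

section ParentGraph

variable {W : Type*} {r : W} {par : W → W} {rank : W → ℕ}

lemma parentGraph_adj_par (h : ∀ x, x ≠ r → rank (par x) < rank x) {x : W} (hx : x ≠ r) :
    (parentGraph r par).Adj x (par x) := by
  rw [parentGraph, SimpleGraph.fromRel_adj]
  refine ⟨fun hxp => ?_, Or.inl ⟨hx, rfl⟩⟩
  have := h x hx
  rw [← hxp] at this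
  exact lt_irrefl _ this

lemma parentGraph_reachable (h : ∀ x, x ≠ r → rank (par x) < rank x) (x : W) :
    (parentGraph r par).Reachable r x := by
  induction hn : rank x using Nat.strong_induction_on generalizing x with
  | _ n ih =>
    by_cases hx : x = r
    · rw [hx]
    · exact (ih _ (hn ▸ h x hx) (par x) rfl).trans (parentGraph_adj_par h hx).symm.reachable

lemma parentGraph_connected (h : ∀ x, x ≠ r → rank (par x) < rank x) :
    (parentGraph r par).Connected :=
  (SimpleGraph.connected_iff_exists_forall_reachable _).2 ⟨r, parentGraph_reachable h⟩

lemma parentGraph_isTree [Finite W] (h : ∀ x, x ≠ r → rank (par x) < rank x) :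
    (parentGraph r par).IsTree := by
  classical
  have := Fintype.ofFinite W
  have hc := parentGraph_connected h
  rw [SimpleGraph.isTree_iff_connected_and_card]
  refine ⟨hc, le_antisymm ?_ hc.card_vert_le_card_edgeSet_add_one⟩
  have hsub : (parentGraph r par).edgeSet ⊆ (fun x => s(x, par x)) '' {r}ᶜ := by
    intro e
    induction e using Sym2.ind with
    | _ x y =>
      rw [SimpleGraph.mem_edgeSet, parentGraph, SimpleGraph.fromRel_adj]
      rintro ⟨-, ⟨hx, rfl⟩ | ⟨hy, rfl⟩⟩
      · exact ⟨x, hx, rfl⟩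
      · exact ⟨y, hy, Sym2.eq_swap⟩
  have h1 := (Set.ncard_le_ncard hsub (Set.toFinite _)).trans
    (Set.ncard_image_le (Set.toFinite _))
  have h2 := Set.ncard_add_ncard_compl ({r} : Set W)
  rw [Set.ncard_singleton] at h2
  rw [Nat.card_coe_set_eq]
  omega

lemma parentGraph_dist_le (h : ∀ x, x ≠ r → rank (par x) < rank x) {x : W} (hx : x ≠ r) :
    (parentGraph r par).dist r x ≤ (parentGraph r par).dist r (par x) + 1 := by
  have h1 := (parentGraph_connected h).dist_triangle (u := r) (v := par x) (w := x)
  rwa [SimpleGraph.dist_eq_one_iff_adj.2 (parentGraph_adj_par h hx).symm] at h1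

end ParentGraph

section Heap

variable {V : Type*} {n : ℕ}

/-- The parent map of the `Δ`-ary heap on `V` ordered by `e`, with an additional root `none` above
the first element. -/
def heapParent (Δ : ℕ) (e : V ≃ Fin n) : Option V → Option V
  | none => none
  | some v => if (e v : ℕ) = 0 then none
      else some (e.symm ⟨((e v : ℕ) - 1) / Δ,
        ((Nat.div_le_self _ _).trans (Nat.sub_le _ _)).trans_lt (e v).2⟩)

/-- The position of a vertex in the heap order, the root `none` being first. -/
def heapRank (e : V ≃ Fin n) : Option V → ℕ
  | none => 0
  | some v => e v + 1

variable {Δ : ℕ} {e : V ≃ Fin n}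

lemma heapParent_of_eq_zero {v : V} (h : (e v : ℕ) = 0) : heapParent Δ e (some v) = none := by
  simp [heapParent, h]

lemma heapParent_eq_none {v : V} : heapParent Δ e (some v) = none ↔ (e v : ℕ) = 0 := by
  simp [heapParent]

lemma heapParent_eq_some {v w : V} :
    heapParent Δ e (some v) = some w ↔ (e v : ℕ) ≠ 0 ∧ ((e v : ℕ) - 1) / Δ = e w := by
  by_cases h : (e v : ℕ) = 0
  · simp [heapParent, h]
  · simp [heapParent, h, Equiv.symm_apply_eq, Fin.ext_iff]

lemma heapRank_heapParent_lt (x : Option V) (hx : x ≠ none) :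
    heapRank e (heapParent Δ e x) < heapRank e x := by
  obtain ⟨v, rfl⟩ := Option.ne_none_iff_exists'.1 hx
  rcases hp : heapParent Δ e (some v) with _ | w
  · simp [heapRank]
  · obtain ⟨h0, hw⟩ := heapParent_eq_some.1 hp
    have := Nat.div_le_self ((e v : ℕ) - 1) Δ
    simp only [heapRank]
    omega

lemma parentGraph_heapParent_adj_none {x : Option V} :
    (parentGraph none (heapParent Δ e)).Adj none x ↔ ∃ v, x = some v ∧ (e v : ℕ) = 0 := by
  rw [parentGraph, SimpleGraph.fromRel_adj]
  cases x with
  | none => simp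
  | some v => simp [heapParent_eq_none]

lemma parentGraph_heapParent_degree_none (hn : 0 < n)
    [Fintype ((parentGraph none (heapParent Δ e)).neighborSet none)] :
    (parentGraph none (heapParent Δ e)).degree none = 1 := by
  rw [SimpleGraph.degree_eq_one_iff_existsUnique_adj]
  refine ⟨some (e.symm ⟨0, hn⟩), parentGraph_heapParent_adj_none.2 ⟨_, rfl, by simp⟩, ?_⟩
  intro y hy
  obtain ⟨v, rfl, hv⟩ := parentGraph_heapParent_adj_none.1 hy
  rw [Option.some_inj, Equiv.eq_symm_apply]
  exact Fin.ext hv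

lemma parentGraph_heapParent_degree_some_le (hΔ : 0 < Δ) (v : V)
    [Fintype ((parentGraph none (heapParent Δ e)).neighborSet (some v))] :
    (parentGraph none (heapParent Δ e)).degree (some v) ≤ Δ + 1 := by
  classical
  let child : ℕ → Option V := fun i =>
    if h : Δ * e v + 1 + i < n then some (e.symm ⟨_, h⟩) else none
  have hsub : (parentGraph none (heapParent Δ e)).neighborFinset (some v) ⊆
      insert (heapParent Δ e (some v)) ((Finset.range Δ).image child) := by
    intro x hx
    rw [SimpleGraph.mem_neighborFinset, parentGraph, SimpleGraph.fromRel_adj] at hx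
    obtain ⟨-, ⟨-, rfl⟩ | ⟨hx, hp⟩⟩ := hx
    · exact Finset.mem_insert_self _ _
    · obtain ⟨w, rfl⟩ := Option.ne_none_iff_exists'.1 hx
      obtain ⟨h0, hw⟩ := heapParent_eq_some.1 hp
      refine Finset.mem_insert_of_mem (Finset.mem_image.2
        ⟨((e w : ℕ) - 1) % Δ, Finset.mem_range.2 (Nat.mod_lt _ hΔ), ?_⟩)
      have hdm : Δ * e v + 1 + ((e w : ℕ) - 1) % Δ = e w := by
        have := Nat.div_add_mod ((e w : ℕ) - 1) Δ
        rw [hw] at this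
        omega
      simp only [child, hdm, Fin.is_lt, dite_true, Fin.eta, Equiv.symm_apply_apply]
  calc (parentGraph none (heapParent Δ e)).degree (some v)
      ≤ _ := Finset.card_le_card hsub
    _ ≤ _ := Finset.card_insert_le _ _
    _ ≤ Δ + 1 := by
      have := Finset.card_image_le (s := Finset.range Δ) (f := child)
      rw [Finset.card_range] at this
      omega

lemma parentGraph_heapParent_dist_le (hΔ : 2 ≤ Δ) (v : V) :
    (parentGraph none (heapParent Δ e)).dist none (some v) ≤
      if (e v : ℕ) = 0 then 1 else Nat.log Δ (e v) + 2 := by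
  induction hm : (e v : ℕ) using Nat.strong_induction_on generalizing v with
  | _ m ih =>
    have hd := parentGraph_dist_le (heapRank_heapParent_lt (Δ := Δ) (e := e))
      (Option.some_ne_none v)
    split_ifs with h0
    · rwa [heapParent_of_eq_zero (hm.trans h0), SimpleGraph.dist_self] at hd
    · rcases hp : heapParent Δ e (some v) with _ | w
      · exact absurd (heapParent_eq_none.1 hp) (hm ▸ h0)
      · obtain ⟨-, hw⟩ := heapParent_eq_some.1 hp
        rw [hm] at hw
        have hle : Δ * (e w : ℕ) ≤ m - 1 := hw ▸ Nat.mul_div_le _ _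
        have hlt : (e w : ℕ) < m := by
          have := Nat.div_le_self (m - 1) Δ
          omega
        have hi := ih _ hlt w rfl
        rw [hp] at hd
        split_ifs at hi with hw0
        · omega
        · have hlog : Nat.log Δ (e w) + 1 ≤ Nat.log Δ m := by
            rw [← Nat.log_mul_base hΔ hw0, mul_comm]
            exact Nat.log_mono_right (by omega)
          omega

lemma parentGraph_heapParent_dist_le_logb (hΔ : 2 ≤ Δ) (v : V) :
    ((parentGraph none (heapParent Δ e)).dist none (some v) : ℝ) ≤
      Real.logb Δ ((e v : ℕ) + 1) + 2 := by
  have hΔ' : (1 : ℝ) < Δ := by exact_mod_cast hΔ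
  have hd := parentGraph_heapParent_dist_le (e := e) hΔ v
  have hmono : (Nat.log Δ (e v) : ℝ) ≤ Real.logb Δ ((e v : ℕ) + 1) := by
    refine (Nat.cast_le.2 (Nat.log_mono_right (Nat.le_succ _))).trans
      ((Real.natLog_le_logb (e v + 1) Δ).trans ?_)
    push_cast
    exact le_rfl
  have hd' : (parentGraph none (heapParent Δ e)).dist none (some v) ≤ Nat.log Δ (e v) + 2 := by
    split_ifs at hd <;> omega
  have : ((parentGraph none (heapParent Δ e)).dist none (some v) : ℝ) ≤ Nat.log Δ (e v) + 2 := by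
    exact_mod_cast hd'
  linarith

end Heap

lemma exists_equiv_fin_antitone {V : Type*} [Fintype V] (q : V → ℝ) :
    ∃ e : V ≃ Fin (Fintype.card V), Antitone (q ∘ e.symm) := by
  let e₀ := Fintype.equivFin V
  let σ := Tuple.sort fun i => -q (e₀.symm i)
  refine ⟨e₀.trans σ.symm, fun i j hij => ?_⟩
  have := Tuple.monotone_sort (fun i => -q (e₀.symm i)) hij
  simpa [σ] using this

lemma succ_mul_le_sum_of_antitone {V : Type*} [Fintype V] {n : ℕ} {q : V → ℝ}
    (hq : ∀ v, 0 ≤ q v) {e : V ≃ Fin n} (he : Antitone (q ∘ e.symm)) (v : V) :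
    ((e v : ℕ) + 1) * q v ≤ ∑ w, q w := by
  calc ((e v : ℕ) + 1) * q v = ∑ _i ∈ Finset.Iic (e v), q v := by
        simp [Fin.card_Iic]
    _ ≤ ∑ i ∈ Finset.Iic (e v), q (e.symm i) :=
        Finset.sum_le_sum fun i hi => by simpa using he (Finset.mem_Iic.1 hi)
    _ ≤ ∑ i, q (e.symm i) :=
        Finset.sum_le_sum_of_subset_of_nonneg (Finset.subset_univ _) fun _ _ _ => hq _
    _ = ∑ w, q w := Equiv.sum_comp e.symm q

open Finset SimpleGraph Real

attribute [local instance] Classical.propDecidable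

theorem stmt_3 {V : Type} [Fintype V] [DecidableEq V] [Nonempty V]
    (q : V → ℝ) (hq0 : ∀ v, 0 ≤ q v) (hq1 : ∑ v, q v = 1)
    (Δ : ℕ) (hΔ : 2 ≤ Δ) :
    ∃ T : SimpleGraph (Option V), T.IsTree ∧ T.degree none = 1 ∧
      T.maxDegree ≤ Δ + 1 ∧
      ∑ v, q v * (T.dist none (some v) : ℝ) ≤
        (∑ v, if 0 < q v then q v * Real.logb 2 (1 / q v) else 0) /
          Real.logb 2 (Δ : ℝ) + 2 := by
  obtain ⟨e, he⟩ := exists_equiv_fin_antitone q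
  have hdeg : (parentGraph none (heapParent Δ e)).degree none = 1 :=
    parentGraph_heapParent_degree_none Fintype.card_pos
  refine ⟨parentGraph none (heapParent Δ e), parentGraph_isTree heapRank_heapParent_lt, hdeg,
    SimpleGraph.maxDegree_le_of_forall_degree_le _ _ fun x => ?_, ?_⟩
  · cases x with
    | none => omega
    | some v => exact parentGraph_heapParent_degree_some_le (by omega) v
  · have hΔ' : (1 : ℝ) < Δ := by exact_mod_cast hΔ
    have h2 : (2 : ℝ) = ∑ v, 2 * q v := by rw [← Finset.mul_sum, hq1, mul_one]
    conv_rhs => rw [Finset.sum_div]; arg 2; rw [h2]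
    rw [← Finset.sum_add_distrib]
    refine Finset.sum_le_sum fun v _ => ?_
    rcases (hq0 v).eq_or_lt with hv | hv
    · simp [← hv]
    · have hle : ((e v : ℕ) + 1 : ℝ) ≤ 1 / q v := by
        rw [le_div_iff₀ hv]
        exact (succ_mul_le_sum_of_antitone hq0 he v).trans_eq hq1
      have hlog : Real.logb Δ ((e v : ℕ) + 1) ≤ Real.logb Δ (1 / q v) :=
        Real.logb_le_logb_of_le hΔ' (by positivity) hle
      have hbase : Real.logb 2 (1 / q v) / Real.logb 2 Δ = Real.logb Δ (1 / q v) :=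
        div_div_div_cancel_right₀ (Real.log_pos one_lt_two).ne' _ _
      rw [if_pos hv, mul_div_assoc, hbase, mul_comm 2, ← mul_add]
      exact mul_le_mul_of_nonneg_left
        ((parentGraph_heapParent_dist_le_logb hΔ v).trans (by linarith)) hv.le
end

section
/- Let G be a simple graph on a finite vertex set V with n = |V| ≥ 1 and m edges satisfying 2m ≥ n, and suppose the maximum degree of G is at most Δmax with Δmax ≥ 2. Then there exists a simple graph G' on V such that (maxDegree of G' : ℝ) ≤ 8 · (2m/n), and for all u, v ∈ V that are reachable in G: u and v are reachable in G' and (d_{G'}(u,v) : ℝ) ≤ 2 · ⌈log₂(Δmax + 1)⌉ · d_G(u,v). -/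
open Finset SimpleGraph Real

attribute [local instance] Classical.propDecidable

/-- Any finite set can be distributed over a nonempty finite type in a balanced way. -/
theorem exists_balanced_map {α V : Type} [Fintype V] (s : Finset α)
    (hn : 1 ≤ Fintype.card V) :
    ∃ f : α → V, ∀ w, #{e ∈ s | f e = w} ≤ (#s - 1) / Fintype.card V + 1 := by
  let n := Fintype.card V
  let idx : α → ℕ := fun e => if h : e ∈ s then (s.equivFin ⟨e, h⟩ : ℕ) else 0
  have idx_lt : ∀ e ∈ s, idx e < #s := fun e he => by simp [idx, he]
  have idx_inj : ∀ a ∈ s, ∀ b ∈ s, idx a = idx b → a = b := fun a ha b hb h => by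
    simp only [idx, ha, hb, dif_pos] at h
    simpa using s.equivFin.injective (Fin.ext h)
  let g : α → Fin n := fun e => ⟨idx e % n, Nat.mod_lt _ hn⟩
  refine ⟨fun e => (Fintype.equivFin V).symm (g e), fun w => ?_⟩
  rw [← card_range ((#s - 1) / Fintype.card V + 1)]
  refine card_le_card_of_injOn (fun e => idx e / n) ?_ ?_
  · intro e he
    have he' : e ∈ s := (mem_filter.1 he).1
    have := idx_lt e he'
    simp only [coe_range, Set.mem_Iio]
    exact Nat.lt_succ_of_le (Nat.div_le_div_right (by omega))
  · intro a ha b hb hab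
    obtain ⟨ha, haw⟩ := mem_filter.1 ha
    obtain ⟨hb, hbw⟩ := mem_filter.1 hb
    have hmod : idx a % n = idx b % n :=
      congrArg Fin.val ((Fintype.equivFin V).symm.injective (haw.trans hbw.symm))
    refine idx_inj a ha b hb ?_
    rw [← Nat.div_add_mod (idx a) n, ← Nat.div_add_mod (idx b) n, hmod]
    simp only at hab
    rw [hab]

/-- The neighbours of a vertex can be listed at positions `2, …, degree + 1`. -/
theorem exists_neighbor_enumeration {V : Type} [Fintype V] (G : SimpleGraph V) (u : V) :
    ∃ nb : ℕ → V, (∀ j ∈ Set.Icc 2 (G.degree u + 1), G.Adj u (nb j)) ∧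
      Set.InjOn nb (Set.Icc 2 (G.degree u + 1)) ∧
      ∀ v, G.Adj u v → ∃ j ∈ Set.Icc 2 (G.degree u + 1), nb j = v := by
  let e := (G.neighborFinset u).equivFin
  let nb : ℕ → V := fun j =>
    if h : j - 2 < #(G.neighborFinset u) then (e.symm ⟨j - 2, h⟩ : V) else u
  have hlt : ∀ j ∈ Set.Icc 2 (G.degree u + 1), j - 2 < #(G.neighborFinset u) := by
    rintro j ⟨h1, h2⟩
    rw [card_neighborFinset_eq_degree]
    omega
  refine ⟨nb, fun j hj => ?_, fun i hi j hj hij => ?_, fun v hv => ?_⟩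
  · simp only [nb, hlt j hj, dif_pos]
    exact (mem_neighborFinset _ _ _).1 (e.symm ⟨j - 2, hlt j hj⟩).2
  · simp only [nb, hlt i hi, hlt j hj, dif_pos] at hij
    have := congrArg Fin.val (e.symm.injective (Subtype.ext hij))
    simp only at this
    have h1 := hi.1
    have h2 := hj.1
    omega
  · have hv' : v ∈ G.neighborFinset u := (mem_neighborFinset _ _ _).2 hv
    have hlt' := (e ⟨v, hv'⟩).2
    refine ⟨e ⟨v, hv'⟩ + 2, ⟨by omega, ?_⟩, ?_⟩
    · have := G.card_neighborFinset_eq_degree u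
      omega
    · simp only [nb, Nat.add_sub_cancel, hlt', dif_pos, Fin.eta]
      exact congrArg Subtype.val (e.symm_apply_apply ⟨v, hv'⟩)

/-- The union of binary heaps, one per vertex `u`, in which the entry `j` of the heap of `u` is
the vertex `node u j` and the heap occupies positions `1, …, size u`. -/
def heapGraph {V : Type} (node : V → ℕ → V) (size : V → ℕ) : SimpleGraph V :=
  SimpleGraph.fromRel fun a b => ∃ u j, 2 ≤ j ∧ j ≤ size u ∧ node u j = a ∧ node u (j / 2) = b

theorem heapGraph_exists_walk {V : Type} {node : V → ℕ → V} {size : V → ℕ}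
    (hroot : ∀ u, node u 1 = u) (u : V) (j : ℕ) (h1 : 1 ≤ j) (hj : j ≤ size u) :
    ∃ p : (heapGraph node size).Walk (node u j) u, p.length ≤ Nat.log 2 j := by
  induction j using Nat.strong_induction_on with
  | _ j ih =>
    rcases h1.eq_or_lt with rfl | h2
    · exact ⟨Walk.nil.copy rfl (hroot u), by simp⟩
    · obtain ⟨p, hp⟩ := ih (j / 2) (by omega) (by omega) (by omega)
      have hlog : Nat.log 2 j = Nat.log 2 (j / 2) + 1 := Nat.log_of_one_lt_of_le (by norm_num) h2
      by_cases hne : node u j = node u (j / 2)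
      · exact ⟨p.copy hne.symm rfl, by simp; omega⟩
      · have hadj : (heapGraph node size).Adj (node u j) (node u (j / 2)) :=
          (fromRel_adj _ _ _).2 ⟨hne, Or.inl ⟨u, j, h2, hj, rfl, rfl⟩⟩
        exact ⟨Walk.cons hadj p, by simp; omega⟩

theorem heapGraph_degree_le {V : Type} [Fintype V] {node : V → ℕ → V} {size : V → ℕ}
    (hroot : ∀ u, node u 1 = u) (w : V) (S : Finset (V × ℕ))
    (hS : ∀ u j, 2 ≤ j → j ≤ size u → node u j = w → (u, j) ∈ S) :
    (heapGraph node size).degree w ≤ 3 * #S + 2 := by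
  let N : Finset V := S.image (fun x => node x.1 (x.2 / 2)) ∪
    (S.image (fun x => node x.1 (2 * x.2)) ∪
      (S.image (fun x => node x.1 (2 * x.2 + 1)) ∪ {node w 2, node w 3}))
  have hsub : (heapGraph node size).neighborFinset w ⊆ N := by
    intro x hx
    rw [mem_neighborFinset, heapGraph, fromRel_adj] at hx
    simp only [N, mem_union, mem_image, mem_insert, mem_singleton, Prod.exists]
    rcases hx.2 with ⟨u, j, h2, hj, rfl, rfl⟩ | ⟨u, j, h2, hj, rfl, hw⟩
    · exact Or.inl ⟨u, j, hS u j h2 hj rfl, rfl⟩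
    · right
      by_cases h4 : 2 ≤ j / 2
      · have hmem := hS u (j / 2) h4 (by omega) hw
        rcases Nat.even_or_odd' j with ⟨i, rfl | rfl⟩
        · exact Or.inl ⟨u, _, hmem, by congr 1; omega⟩
        · exact Or.inr (Or.inl ⟨u, _, hmem, by congr 1; omega⟩)
      · have hj1 : j / 2 = 1 := by omega
        rw [hj1, hroot] at hw
        subst hw
        have : j = 2 ∨ j = 3 := by omega
        rcases this with rfl | rfl <;> simp
  rw [← card_neighborFinset_eq_degree]
  refine (card_le_card hsub).trans ?_
  have h1 := card_union_le (S.image (fun x => node x.1 (x.2 / 2)))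
    (S.image (fun x => node x.1 (2 * x.2)) ∪
      (S.image (fun x => node x.1 (2 * x.2 + 1)) ∪ {node w 2, node w 3}))
  have h2 := card_union_le (S.image (fun x => node x.1 (2 * x.2)))
      (S.image (fun x => node x.1 (2 * x.2 + 1)) ∪ {node w 2, node w 3})
  have h3 := card_union_le (S.image (fun x => node x.1 (2 * x.2 + 1))) {node w 2, node w 3}
  have h4 := card_le_two (a := node w 2) (b := node w 3)
  have h5 := card_image_le (s := S) (f := fun x => node x.1 (x.2 / 2))
  have h6 := card_image_le (s := S) (f := fun x => node x.1 (2 * x.2))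
  have h7 := card_image_le (s := S) (f := fun x => node x.1 (2 * x.2 + 1))
  simp only [N]
  omega

theorem card_ordered_pairs_le {V : Type} [Fintype V] (E : Finset (Sym2 V)) :
    #{x : V × V | s(x.1, x.2) ∈ E} ≤ 2 * #E := by
  refine card_le_mul_card_image_of_maps_to (f := fun x : V × V => s(x.1, x.2)) ?_ 2 ?_
  · intro x hx
    simpa using hx
  · intro e _
    induction e using Sym2.ind with
    | _ a b =>
      refine (card_le_card (t := {(a, b), (b, a)}) ?_).trans card_le_two
      rintro ⟨x, y⟩ hx
      simpa using (mem_filter.1 hx).2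

/-- If the endpoints of every edge of `G` are joined in `H` by walks of length at most `c`, then
`H` stretches walks of `G` by a factor of at most `c`. -/
theorem exists_walk_of_forall_adj {V : Type} {G H : SimpleGraph V} {c : ℕ}
    (h : ∀ u v, G.Adj u v → ∃ p : H.Walk u v, p.length ≤ c) {u v : V} (q : G.Walk u v) :
    ∃ p : H.Walk u v, p.length ≤ c * q.length := by
  induction q with
  | nil => exact ⟨Walk.nil, by simp⟩
  | cons hadj q ih =>
    obtain ⟨p, hp⟩ := ih
    obtain ⟨r, hr⟩ := h _ _ hadj
    refine ⟨r.append p, ?_⟩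
    rw [Walk.length_append, Walk.length_cons, mul_add, mul_one]
    omega

theorem exists_graph_degree_le_stretch {V : Type} [Fintype V] (G : SimpleGraph V)
    (hn : 1 ≤ Fintype.card V) (Δ : ℕ) (hdeg : ∀ v, G.degree v ≤ Δ) :
    ∃ H : SimpleGraph V,
      (∀ w, H.degree w ≤ 6 * ((#G.edgeFinset - 1) / Fintype.card V + 1) + 2) ∧
      ∀ u v, G.Adj u v → ∃ p : H.Walk u v, p.length ≤ 2 * Nat.log 2 (Δ + 1) := by
  obtain ⟨f, hf⟩ := exists_balanced_map (V := V) G.edgeFinset hn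
  choose nb hadj hinj hsurj using exists_neighbor_enumeration G
  let node : V → ℕ → V := fun u j => if j = 1 then u else f s(u, nb u j)
  have hroot : ∀ u, node u 1 = u := fun u => by simp [node]
  have hnode : ∀ u j, 2 ≤ j → node u j = f s(u, nb u j) := fun u j hj => by
    simp only [node]
    rw [if_neg (by omega)]
  refine ⟨heapGraph node fun u => G.degree u + 1, fun w => ?_, fun u v huv => ?_⟩
  · let S : Finset (V × ℕ) := {x ∈ univ ×ˢ range (Δ + 2) |
      (2 ≤ x.2 ∧ x.2 ≤ G.degree x.1 + 1) ∧ node x.1 x.2 = w}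
    have hS : ∀ u j, 2 ≤ j → j ≤ G.degree u + 1 → node u j = w → (u, j) ∈ S := by
      intro u j h2 hj hw
      have := hdeg u
      simp only [S, mem_filter, mem_product, mem_univ, mem_range, true_and]
      exact ⟨by omega, ⟨h2, hj⟩, hw⟩
    refine (heapGraph_degree_le hroot w S hS).trans ?_
    have hcard : #S ≤ #{x : V × V | s(x.1, x.2) ∈ {e ∈ G.edgeFinset | f e = w}} := by
      refine card_le_card_of_injOn (fun x => (x.1, nb x.1 x.2)) ?_ ?_
      · rintro ⟨u, j⟩ hx
        obtain ⟨-, hj, hw⟩ := mem_filter.1 hx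
        have ha := hadj u j hj
        rw [hnode u j hj.1] at hw
        simp [ha, hw]
      · rintro ⟨u, i⟩ hx ⟨v, j⟩ hy hxy
        obtain ⟨-, hi, -⟩ := mem_filter.1 hx
        obtain ⟨-, hj, -⟩ := mem_filter.1 hy
        simp only [Prod.mk.injEq] at hxy
        obtain ⟨rfl, hxy⟩ := hxy
        exact congrArg (Prod.mk u) (hinj u hi hj hxy)
    have := card_ordered_pairs_le {e ∈ G.edgeFinset | f e = w}
    have := hf w
    omega
  · have key : ∀ u v, G.Adj u v → ∃ p : (heapGraph node fun u => G.degree u + 1).Walk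
        (f s(u, v)) u, p.length ≤ Nat.log 2 (Δ + 1) := by
      intro u v huv
      obtain ⟨j, hj, rfl⟩ := hsurj u v huv
      obtain ⟨p, hp⟩ := heapGraph_exists_walk (size := fun u => G.degree u + 1) hroot u j
        (by have := hj.1; omega) hj.2
      refine ⟨p.copy (hnode u j hj.1) rfl, ?_⟩
      rw [Walk.length_copy]
      exact hp.trans (Nat.log_mono_right (hj.2.trans (Nat.succ_le_succ (hdeg u))))
    obtain ⟨p, hp⟩ := key u v huv
    obtain ⟨q, hq⟩ := key v u huv.symm
    refine ⟨p.reverse.append (q.copy (by rw [Sym2.eq_swap]) rfl), ?_⟩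
    rw [Walk.length_append, Walk.length_reverse, Walk.length_copy]
    omega

theorem natLog_two_le_ceil_logb (n : ℕ) :
    (Nat.log 2 n : ℝ) ≤ (⌈Real.logb 2 (n : ℝ)⌉ : ℝ) :=
  (Real.natLog_le_logb n 2).trans (Int.le_ceil _)

theorem stmt_6 {V : Type} [Fintype V] [DecidableEq V]
    (G : SimpleGraph V) (hn : 1 ≤ Fintype.card V)
    (hm : Fintype.card V ≤ 2 * G.edgeFinset.card)
    (Δmax : ℕ) (hΔ : 2 ≤ Δmax) (hdeg : G.maxDegree ≤ Δmax) :
    ∃ G' : SimpleGraph V,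
      (G'.maxDegree : ℝ) ≤ 8 * (2 * (G.edgeFinset.card : ℝ) / (Fintype.card V : ℝ)) ∧
      ∀ u v : V, G.Reachable u v →
        G'.Reachable u v ∧
        (G'.dist u v : ℝ) ≤
          2 * (⌈Real.logb 2 ((Δmax : ℝ) + 1)⌉ : ℝ) * (G.dist u v : ℝ) := by
  obtain ⟨H, hH, hwalk⟩ := exists_graph_degree_le_stretch G hn Δmax
    fun v => (G.degree_le_maxDegree v).trans hdeg
  refine ⟨H, ?_, fun u v huv => ?_⟩
  · have hmax : H.maxDegree ≤ 6 * ((#G.edgeFinset - 1) / Fintype.card V + 1) + 2 :=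
      H.maxDegree_le_of_forall_degree_le _ hH
    have hmul : H.maxDegree * Fintype.card V ≤ 16 * #G.edgeFinset := by
      refine (Nat.mul_le_mul_right _ hmax).trans ?_
      have hdiv := Nat.div_mul_le_self (#G.edgeFinset - 1) (Fintype.card V)
      generalize (#G.edgeFinset - 1) / Fintype.card V = k at hdiv
      rcases k.eq_zero_or_pos with rfl | hk
      · omega
      · have : Fintype.card V ≤ k * Fintype.card V := Nat.le_mul_of_pos_left _ hk
        calc (6 * (k + 1) + 2) * Fintype.card V
            = 6 * (k * Fintype.card V) + 8 * Fintype.card V := by ring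
          _ ≤ 16 * #G.edgeFinset := by omega
    have hpos : (0 : ℝ) < Fintype.card V := by exact_mod_cast hn
    have hmul' : (H.maxDegree : ℝ) * Fintype.card V ≤ 16 * #G.edgeFinset := by exact_mod_cast hmul
    rw [← mul_div_assoc, le_div_iff₀ hpos]
    linarith
  · obtain ⟨q, hq⟩ := huv.exists_walk_length_eq_dist
    obtain ⟨p, hp⟩ := exists_walk_of_forall_adj hwalk q
    refine ⟨p.reachable, ?_⟩
    have hdist : (H.dist u v : ℝ) ≤ 2 * Nat.log 2 (Δmax + 1) * G.dist u v := by
      exact_mod_cast hq ▸ (dist_le p).trans hp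
    refine hdist.trans ?_
    have hlog := natLog_two_le_ceil_logb (Δmax + 1)
    push_cast at hlog
    gcongr
end

section
/- There is a universal constant a > 0 such that the following holds. Let V be a finite vertex set with n = |V|, let r ≥ 2, let G be an r-regular simple graph on V (every vertex has degree r), and let p be the uniform demand on G. Suppose S is a simple graph on V with maximum degree at most r and at most k·n edges (for a real k ≥ 1), such that every pair of vertices adjacent in G is reachable in S and EPL(p, S) ≤ c for some real c ≥ 1. Then there exists a simple graph N on V with (maxDegree of N : ℝ) ≤ 16k, every pair adjacent in G reachable in N, and EPL(p, N) ≤ a · c · log₂ r. -/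
open Finset SimpleGraph Real

attribute [local instance] Classical.propDecidable

/-- The uniform demand on a graph `G`: probability `1/(2m)` on each ordered adjacent pair. -/
noncomputable def uniformDemand {V : Type} [Fintype V] [DecidableEq V]
    (G : SimpleGraph V) : V → V → ℝ :=
  fun u v => if G.Adj u v then 1 / (2 * (G.edgeFinset.card : ℝ)) else 0

theorem exists_injOn_lt_card {α : Type*} (s : Finset α) :
    ∃ f : α → ℕ, Set.InjOn f s ∧ ∀ a ∈ s, f a < s.card := by
  refine ⟨fun a => if ha : a ∈ s then (s.equivFin ⟨a, ha⟩ : ℕ) else 0, ?_, ?_⟩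
  · intro a ha b hb hab
    simp only [Finset.mem_coe] at ha hb
    simp only [ha, hb, dif_pos] at hab
    simpa using s.equivFin.injective (Fin.ext hab)
  · intro a ha
    simp [ha]

theorem card_filter_div_eq_le {α : Type*} (s : Finset α) {f : α → ℕ} (hf : Set.InjOn f s)
    {B : ℕ} (hB : 0 < B) (i : ℕ) : (s.filter fun a => f a / B = i).card ≤ B := by
  have h : (s.filter fun a => f a / B = i).card ≤ (Finset.Ico (i * B) (i * B + B)).card := by
    refine Finset.card_le_card_of_injOn f ?_ (hf.mono fun a ha => ?_)
    · intro a ha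
      have ha' := (Finset.mem_filter.mp (Finset.mem_coe.mp ha)).2
      rw [Nat.div_eq_iff hB] at ha'
      simp only [Finset.coe_Ico, Set.mem_Ico]
      omega
    · exact (Finset.mem_filter.mp (Finset.mem_coe.mp ha)).1
  simpa using h

/-- If each edge of `S` is replaced by a walk of length at most `L` in `N`, distances grow by a
factor at most `L`. -/
theorem reachable_and_dist_le_mul_dist {V : Type*} {S N : SimpleGraph V} {L : ℕ}
    (h : ∀ u v, S.Adj u v → ∃ p : N.Walk u v, p.length ≤ L) {u v : V} (huv : S.Reachable u v) :
    N.Reachable u v ∧ N.dist u v ≤ L * S.dist u v := by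
  have key : ∀ {u v : V} (q : S.Walk u v), ∃ p : N.Walk u v, p.length ≤ L * q.length := by
    intro u v q
    induction q with
    | nil => exact ⟨.nil, by simp⟩
    | cons hadj q ih =>
      obtain ⟨p, hp⟩ := ih
      obtain ⟨p', hp'⟩ := h _ _ hadj
      refine ⟨p'.append p, ?_⟩
      rw [Walk.length_append, Walk.length_cons]
      linarith
  obtain ⟨q, hq⟩ := huv.exists_walk_length_eq_dist
  obtain ⟨p, hp⟩ := key q
  exact ⟨⟨p⟩, (N.dist_le p).trans (hq ▸ hp)⟩

/-- If every edge of `N` is the image under `h` of a pair related by `R`, and every vertex has at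
most two preimages among the points related to something, degrees at most double. -/
theorem degree_le_two_mul_of_adj_imp {V Z : Type*} [Fintype V] {N : SimpleGraph V} {h : Z → V}
    {R : Z → Z → Prop} (hN : ∀ x y, N.Adj x y → ∃ a b, h a = x ∧ h b = y ∧ R a b) {D : ℕ}
    (nbr : Z → Finset Z) (hnbr : ∀ a b, R a b → b ∈ nbr a) (hcard : ∀ a, (nbr a).card ≤ D)
    (hfib : ∀ x, ∃ a b, ∀ z w, R z w → h z = x → z = a ∨ z = b) (x : V) :
    N.degree x ≤ 2 * D := by
  obtain ⟨a, b, hab⟩ := hfib x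
  rw [← SimpleGraph.card_neighborFinset_eq_degree]
  calc _ ≤ ((nbr a ∪ nbr b).image h).card := by
        refine Finset.card_le_card fun y hy => ?_
        obtain ⟨c, d, hc, rfl, hcd⟩ := hN x y ((N.mem_neighborFinset x y).mp hy)
        refine Finset.mem_image_of_mem h (Finset.mem_union.mpr ?_)
        rcases hab c d hcd hc with rfl | rfl
        · exact Or.inl (hnbr _ _ hcd)
        · exact Or.inr (hnbr _ _ hcd)
    _ ≤ (nbr a ∪ nbr b).card := Finset.card_image_le
    _ ≤ (nbr a).card + (nbr b).card := Finset.card_union_le _ _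
    _ ≤ 2 * D := by linarith [hcard a, hcard b]

/-- The nodes `(v, i)` with `i ≤ d v / B` can be placed on `V` at most two to one, with `(v, 0)`
placed at `v`. -/
theorem exists_two_to_one_placement {V : Type*} [Fintype V] {d : V → ℕ} {B : ℕ} (hB : 0 < B)
    (hsum : ∑ v, d v ≤ B * Fintype.card V) :
    ∃ h : V × ℕ → V, (∀ v, h (v, 0) = v) ∧
      ∀ x, ∃ a b, ∀ z, z.2 ≤ d z.1 / B → h z = x → z = a ∨ z = b := by
  have hcardle : Fintype.card (Σ v, Fin (d v / B)) ≤ Fintype.card V := by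
    simp only [Fintype.card_sigma, Fintype.card_fin]
    refine Nat.le_of_mul_le_mul_left (le_trans ?_ hsum) hB
    rw [Finset.mul_sum]
    exact Finset.sum_le_sum fun v _ => Nat.mul_div_le _ _
  obtain ⟨φ⟩ := Function.Embedding.nonempty_of_card_le hcardle
  let h : V × ℕ → V := fun z =>
    if hz : z.2 - 1 < d z.1 / B ∧ z.2 ≠ 0 then φ ⟨z.1, ⟨z.2 - 1, hz.1⟩⟩ else z.1
  have h_zero : ∀ v, h (v, 0) = v := fun v => by simp [h]
  have h_pos : ∀ v i, i ≤ d v / B → i ≠ 0 →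
      ∃ a : Σ v, Fin (d v / B), h (v, i) = φ a ∧ (v, i) = (a.1, (a.2 : ℕ) + 1) := by
    intro v i hv hi
    have hi' : i - 1 < d v / B ∧ i ≠ 0 := ⟨by omega, hi⟩
    refine ⟨⟨v, ⟨i - 1, hi'.1⟩⟩, dif_pos hi', Prod.ext rfl ?_⟩
    simp only
    omega
  refine ⟨h, h_zero, fun x => ?_⟩
  by_cases hx : ∃ a, φ a = x
  · obtain ⟨a, rfl⟩ := hx
    refine ⟨(φ a, 0), (a.1, a.2 + 1), ?_⟩
    rintro ⟨v, i⟩ hv hz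
    by_cases hi : i = 0
    · subst hi
      exact Or.inl (by rw [← hz, h_zero])
    · obtain ⟨b, hb, hvi⟩ := h_pos v i hv hi
      rw [hvi, φ.injective (hb.symm.trans hz)]
      exact Or.inr rfl
  · refine ⟨(x, 0), (x, 0), ?_⟩
    rintro ⟨v, i⟩ hv hz
    by_cases hi : i = 0
    · subst hi
      exact Or.inl (by rw [← hz, h_zero])
    · obtain ⟨b, hb, -⟩ := h_pos v i hv hi
      exact absurd ⟨b, hb.symm.trans hz⟩ hx

/-- Each vertex `v` of degree `d` is split into a binary heap of `d / B + 1` nodes, each carrying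
at most `B` of the edges at `v`. The root sits at `v`, and since `∑ d / B ≤ |V|` the other nodes
can be placed at distinct vertices. -/
theorem exists_degree_le_and_walk_length_le {V : Type*} [Fintype V] (S : SimpleGraph V)
    {B r : ℕ} (hB : 0 < B) (hdeg : ∀ v, S.degree v ≤ r)
    (hsum : ∑ v, S.degree v ≤ B * Fintype.card V) :
    ∃ N : SimpleGraph V, (∀ v, N.degree v ≤ 2 * (B + 3)) ∧
      ∀ u v, S.Adj u v → ∃ p : N.Walk u v, p.length ≤ 2 * Nat.log 2 (r / B + 1) + 1 := by
  choose rank hinj hlt using fun v => exists_injOn_lt_card (S.neighborFinset v)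
  obtain ⟨h, h_zero, hpre⟩ := exists_two_to_one_placement hB hsum
  let R : V × ℕ → V × ℕ → Prop := fun a b =>
    (a.2 ≤ S.degree a.1 / B ∧ b.2 ≤ S.degree b.1 / B) ∧
      ((a.1 = b.1 ∧ (a.2 = (b.2 - 1) / 2 ∨ b.2 = (a.2 - 1) / 2)) ∨
        (S.Adj a.1 b.1 ∧ rank a.1 b.1 / B = a.2 ∧ rank b.1 a.1 / B = b.2))
  have hR : ∀ a b, R a b → R b a := by
    rintro a b ⟨⟨h1, h2⟩, ⟨h3, h4⟩ | ⟨h3, h4, h5⟩⟩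
    · exact ⟨⟨h2, h1⟩, Or.inl ⟨h3.symm, h4.symm⟩⟩
    · exact ⟨⟨h2, h1⟩, Or.inr ⟨h3.symm, h5, h4⟩⟩
  let nbr : V × ℕ → Finset (V × ℕ) := fun a =>
    (((S.neighborFinset a.1).filter fun w => rank a.1 w / B = a.2).image
      fun w => (w, rank w a.1 / B)) ∪
    {(a.1, (a.2 - 1) / 2), (a.1, 2 * a.2 + 1), (a.1, 2 * a.2 + 2)}
  have hnbr : ∀ a b, R a b → b ∈ nbr a := by
    rintro ⟨v, i⟩ ⟨w, j⟩ ⟨-, ⟨h3, h4⟩ | ⟨h3, h4, h5⟩⟩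
    · dsimp only at h3 h4
      subst h3
      refine Finset.mem_union_right _ ?_
      simp only [Finset.mem_insert, Finset.mem_singleton, Prod.mk.injEq, true_and]
      omega
    · refine Finset.mem_union_left _ (Finset.mem_image.mpr ⟨w, ?_, ?_⟩)
      · simpa using ⟨h3, h4⟩
      · simpa using h5
  have hcard : ∀ a, (nbr a).card ≤ B + 3 := fun a =>
    (Finset.card_union_le _ _).trans (add_le_add
      (Finset.card_image_le.trans (card_filter_div_eq_le _ (hinj a.1) hB _)) Finset.card_le_three)
  have hfib : ∀ x, ∃ a b, ∀ z w, R z w → h z = x → z = a ∨ z = b := by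
    intro x
    obtain ⟨a, b, hab⟩ := hpre x
    exact ⟨a, b, fun z w hzw => hab z hzw.1.1⟩
  obtain ⟨N, hN⟩ : ∃ N : SimpleGraph V, ∀ x y, N.Adj x y ↔
      x ≠ y ∧ ∃ a b, h a = x ∧ h b = y ∧ R a b := by
    refine ⟨SimpleGraph.fromRel fun x y => ∃ a b, h a = x ∧ h b = y ∧ R a b, fun x y => ?_⟩
    rw [SimpleGraph.fromRel_adj]
    refine and_congr_right fun _ => or_iff_left_of_imp ?_
    rintro ⟨a, b, ha, hb, hab⟩
    exact ⟨b, a, hb, ha, hR _ _ hab⟩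
  refine ⟨N, degree_le_two_mul_of_adj_imp (fun x y hxy => ((hN x y).mp hxy).2)
    nbr hnbr hcard hfib, ?_⟩
  have step : ∀ a b, R a b → ∃ p : N.Walk (h a) (h b), p.length ≤ 1 := by
    intro a b hab
    by_cases heq : h a = h b
    · rw [heq]
      exact ⟨.nil, by simp⟩
    · have hadj : N.Adj (h a) (h b) := (hN _ _).mpr ⟨heq, a, b, rfl, rfl, hab⟩
      exact ⟨hadj.toWalk, by simp⟩
  have down : ∀ v i, i ≤ S.degree v / B →
      ∃ p : N.Walk v (h (v, i)), p.length ≤ Nat.log 2 (i + 1) := by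
    intro v i
    induction i using Nat.strong_induction_on with
    | _ i ih =>
      intro hi
      by_cases hi0 : i = 0
      · subst hi0
        rw [h_zero]
        exact ⟨.nil, by simp⟩
      · have hpar : (i - 1) / 2 ≤ S.degree v / B := by omega
        obtain ⟨p, hp⟩ := ih ((i - 1) / 2) (by omega) hpar
        obtain ⟨q, hq⟩ := step (v, (i - 1) / 2) (v, i) ⟨⟨hpar, hi⟩, Or.inl ⟨rfl, Or.inl rfl⟩⟩
        refine ⟨p.append q, ?_⟩
        rw [Walk.length_append, Nat.log_of_one_lt_of_le one_lt_two (by omega : 2 ≤ i + 1)]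
        rw [show (i - 1) / 2 + 1 = (i + 1) / 2 by omega] at hp
        omega
  have slot : ∀ u v, S.Adj u v → rank u v / B ≤ S.degree u / B := fun u v huv =>
    Nat.div_le_div_right (hlt u v ((S.mem_neighborFinset u v).mpr huv)).le
  have down' : ∀ u v, S.Adj u v → ∃ p : N.Walk u (h (u, rank u v / B)),
      p.length ≤ Nat.log 2 (r / B + 1) := fun u v huv => by
    obtain ⟨p, hp⟩ := down u _ (slot u v huv)
    exact ⟨p, hp.trans (Nat.log_mono_right (Nat.succ_le_succ
      ((slot u v huv).trans (Nat.div_le_div_right (hdeg u)))))⟩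
  intro u v huv
  obtain ⟨p, hp⟩ := down' u v huv
  obtain ⟨q, hq⟩ := down' v u huv.symm
  obtain ⟨e, he⟩ := step (u, rank u v / B) (v, rank v u / B)
    ⟨⟨slot u v huv, slot v u huv.symm⟩, Or.inr ⟨huv, rfl, rfl⟩⟩
  refine ⟨(p.append e).append q.reverse, ?_⟩
  rw [Walk.length_append, Walk.length_append, Walk.length_reverse]
  omega

theorem EPL_uniformDemand_le_mul {V : Type} [Fintype V] [DecidableEq V] {G S N : SimpleGraph V}
    {L : ℝ} (h : ∀ u v, G.Adj u v → (N.dist u v : ℝ) ≤ L * S.dist u v) :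
    EPL (uniformDemand G) N ≤ L * EPL (uniformDemand G) S := by
  unfold EPL uniformDemand
  simp only [Finset.mul_sum]
  refine Finset.sum_le_sum fun u _ => Finset.sum_le_sum fun v _ => ?_
  split_ifs with huv
  · rw [mul_left_comm]
    exact mul_le_mul_of_nonneg_left (h u v huv) (by positivity)
  · simp

theorem stmt_7 :
    ∃ a : ℝ, 0 < a ∧
      ∀ (V : Type) [Fintype V] [DecidableEq V] (r : ℕ), 2 ≤ r →
        ∀ G : SimpleGraph V, (∀ v, G.degree v = r) →
        ∀ (S : SimpleGraph V) (k c : ℝ), 1 ≤ k → 1 ≤ c →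
          S.maxDegree ≤ r →
          (S.edgeFinset.card : ℝ) ≤ k * (Fintype.card V : ℝ) →
          (∀ u v, G.Adj u v → S.Reachable u v) →
          EPL (uniformDemand G) S ≤ c →
          ∃ N : SimpleGraph V, (N.maxDegree : ℝ) ≤ 16 * k ∧
            (∀ u v, G.Adj u v → N.Reachable u v) ∧
            EPL (uniformDemand G) N ≤ a * c * Real.logb 2 (r : ℝ) := by
  refine ⟨3, by norm_num, ?_⟩
  intro V _ _ r hr G _ S k c hk hc hmax hedges hreach hEPL
  have hB : 2 * k ≤ ⌈2 * k⌉₊ := Nat.le_ceil _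
  have hB' : (⌈2 * k⌉₊ : ℝ) < 2 * k + 1 := Nat.ceil_lt_add_one (by linarith)
  have hB2 : 2 ≤ ⌈2 * k⌉₊ := by
    exact_mod_cast (by linarith : (2 : ℝ) ≤ ⌈2 * k⌉₊)
  have hdeg : ∀ v, S.degree v ≤ r := fun v => (S.degree_le_maxDegree v).trans hmax
  have hsum : ∑ v, S.degree v ≤ ⌈2 * k⌉₊ * Fintype.card V := by
    have h1 : ((∑ v, S.degree v : ℕ) : ℝ) = 2 * (S.edgeFinset.card : ℝ) := by
      rw [S.sum_degrees_eq_twice_card_edges]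
      push_cast
      rfl
    have h2 : ((∑ v, S.degree v : ℕ) : ℝ) ≤ ⌈2 * k⌉₊ * (Fintype.card V : ℝ) := by
      rw [h1]
      nlinarith [mul_le_mul_of_nonneg_right hB (Nat.cast_nonneg (α := ℝ) (Fintype.card V))]
    exact_mod_cast h2
  obtain ⟨N, hN, hwalk⟩ := 
    exists_degree_le_and_walk_length_le S (zero_lt_two.trans_le hB2) hdeg hsum
  have hlog : Nat.log 2 (r / ⌈2 * k⌉₊ + 1) ≤ Nat.log 2 r := by
    have : r / ⌈2 * k⌉₊ ≤ r / 2 := Nat.div_le_div_left hB2 (by norm_num)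
    exact Nat.log_mono_right (by omega)
  have hlogb : (Nat.log 2 r : ℝ) ≤ Real.logb 2 r := by
    exact_mod_cast Real.natLog_le_logb r 2
  have hlog1 : (1 : ℝ) ≤ Real.logb 2 r := by
    rw [Real.le_logb_iff_rpow_le one_lt_two (by positivity), Real.rpow_one]
    exact_mod_cast hr
  have hL : ((2 * Nat.log 2 (r / ⌈2 * k⌉₊ + 1) + 1 : ℕ) : ℝ) ≤ 3 * Real.logb 2 r := by
    have : (Nat.log 2 (r / ⌈2 * k⌉₊ + 1) : ℝ) ≤ Nat.log 2 r := by exact_mod_cast hlog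
    push_cast
    linarith
  refine ⟨N, ?_, fun u v huv => (reachable_and_dist_le_mul_dist hwalk (hreach u v huv)).1, ?_⟩
  · have h1 : (N.maxDegree : ℝ) ≤ (2 * (⌈2 * k⌉₊ + 3) : ℕ) := by
      exact_mod_cast N.maxDegree_le_of_forall_degree_le _ hN
    push_cast at h1
    linarith
  · calc EPL (uniformDemand G) N
        ≤ 3 * Real.logb 2 r * EPL (uniformDemand G) S :=
          EPL_uniformDemand_le_mul fun u v huv => by
            have h1 := (reachable_and_dist_le_mul_dist hwalk (hreach u v huv)).2
            have h2 : (N.dist u v : ℝ) ≤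
                ((2 * Nat.log 2 (r / ⌈2 * k⌉₊ + 1) + 1 : ℕ) : ℝ) * S.dist u v := by
              exact_mod_cast h1
            exact h2.trans (mul_le_mul_of_nonneg_right hL (Nat.cast_nonneg _))
      _ ≤ 3 * Real.logb 2 r * c := mul_le_mul_of_nonneg_left hEPL (by linarith)
      _ = 3 * c * Real.logb 2 r := by ring
end

section
/- There is a universal constant a > 0 such that: for every real c ≥ 1, every natural number Δ ≥ 2, every finite vertex set V with n = |V| ≥ 2, and every simple graph G on V whose minimum degree is at least n^{1/c}, letting p be the uniform demand on G, there exists a simple graph N on V with maximum degree at most Δ+1 such that every pair adjacent in G is reachable in N and EPL(p, N) ≤ a · c · (H(Y∣X)/log₂ Δ + 1). -/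
open Finset SimpleGraph Real

attribute [local instance] Classical.propDecidable

/-- The complete `Δ`-ary tree in heap order: `u` is joined to the vertex numbered
`(f u - 1) / Δ`. -/
def heapTree {V : Type} (f : V → ℕ) (Δ : ℕ) : SimpleGraph V :=
  SimpleGraph.fromRel fun u v => f v = (f u - 1) / Δ

lemma heapTree_degree_le {V : Type} [Fintype V] {f : V → ℕ} (hf : Function.Injective f)
    {Δ : ℕ} (hΔ : 0 < Δ) (u : V) : (heapTree f Δ).degree u ≤ Δ + 1 := by
  rw [← SimpleGraph.card_neighborFinset_eq_degree, ← Finset.card_image_of_injective _ hf]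
  have hsub : ((heapTree f Δ).neighborFinset u).image f ⊆
      insert ((f u - 1) / Δ) (Finset.Icc (Δ * f u + 1) (Δ * f u + Δ)) := by
    intro x hx
    obtain ⟨v, hv, rfl⟩ := Finset.mem_image.mp hx
    rw [SimpleGraph.mem_neighborFinset, heapTree, SimpleGraph.fromRel_adj] at hv
    obtain ⟨hne, h | h⟩ := hv
    · simp [h]
    · have hvu : f u ≠ f v := fun h' => hne (hf h')
      have hv0 : f v ≠ 0 := by
        intro h0
        simp [h0] at h
        omega
      have h1 := Nat.div_add_mod (f v - 1) Δ
      have h2 := Nat.mod_lt (f v - 1) hΔ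
      rw [← h] at h1
      refine Finset.mem_insert_of_mem (Finset.mem_Icc.mpr ⟨?_, ?_⟩) <;> omega
  calc _ ≤ _ := Finset.card_le_card hsub
    _ ≤ _ := Finset.card_insert_le _ _
    _ = Δ + 1 := by simp

lemma heapTree_exists_walk_to_root {V : Type} [Fintype V] (e : V ≃ Fin (Fintype.card V))
    {Δ : ℕ} (r : V) (hr : (e r : ℕ) = 0) (k : ℕ) :
    ∀ u : V, (e u : ℕ) < Δ ^ k →
      ∃ w : (heapTree (fun v => (e v : ℕ)) Δ).Walk u r, w.length ≤ k := by
  induction k with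
  | zero =>
    intro u hu
    obtain rfl : u = r := e.injective (Fin.ext (by rw [pow_zero] at hu; omega))
    exact ⟨.nil, le_rfl⟩
  | succ k ih =>
    intro u hu
    have hle : ((e u : ℕ) - 1) / Δ ≤ e u := (Nat.div_le_self _ _).trans (Nat.sub_le _ _)
    obtain ⟨v, hv⟩ : ∃ v, (e v : ℕ) = ((e u : ℕ) - 1) / Δ :=
      ⟨e.symm ⟨_, hle.trans_lt (e u).isLt⟩, by simp⟩
    have hvk : (e v : ℕ) < Δ ^ k := by
      rw [hv]
      refine Nat.div_lt_of_lt_mul ?_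
      rw [← pow_succ']
      omega
    obtain ⟨w, hw⟩ := ih v hvk
    by_cases huv : u = v
    · subst huv
      exact ⟨w, by omega⟩
    · exact ⟨.cons ((SimpleGraph.fromRel_adj _ _ _).mpr ⟨huv, Or.inl hv⟩) w,
        Nat.succ_le_succ hw⟩

lemma exists_simpleGraph_maxDegree_le_dist_le (V : Type) [Fintype V] [Nonempty V] {Δ : ℕ}
    (hΔ : 0 < Δ) {k : ℕ} (hk : Fintype.card V ≤ Δ ^ k) :
    ∃ N : SimpleGraph V, N.maxDegree ≤ Δ + 1 ∧
      ∀ u v, N.Reachable u v ∧ N.dist u v ≤ 2 * k := by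
  let e := Fintype.equivFin V
  have hroot := heapTree_exists_walk_to_root e (Δ := Δ) (e.symm ⟨0, Fintype.card_pos⟩) (by simp) k
  refine ⟨heapTree (fun v => (e v : ℕ)) Δ, ?_, fun u v => ?_⟩
  · exact SimpleGraph.maxDegree_le_of_forall_degree_le _ _ fun u =>
      heapTree_degree_le (fun a b h => e.injective (Fin.ext h)) hΔ u
  · obtain ⟨p, hp⟩ := hroot u ((e u).isLt.trans_le hk)
    obtain ⟨q, hq⟩ := hroot v ((e v).isLt.trans_le hk)
    refine ⟨(p.append q.reverse).reachable, (SimpleGraph.dist_le (p.append q.reverse)).trans ?_⟩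
    rw [SimpleGraph.Walk.length_append, SimpleGraph.Walk.length_reverse]
    omega

section UniformDemand

variable {V : Type} [Fintype V] [DecidableEq V] (G : SimpleGraph V)

lemma uniformDemand_nonneg (u v : V) : 0 ≤ uniformDemand G u v := by
  unfold uniformDemand
  split_ifs <;> positivity

lemma sum_uniformDemand (u : V) :
    ∑ v, uniformDemand G u v = (G.degree u : ℝ) * (1 / (2 * (G.edgeFinset.card : ℝ))) := by
  unfold uniformDemand
  rw [← Finset.sum_filter, Finset.sum_const, nsmul_eq_mul,
    ← SimpleGraph.card_neighborFinset_eq_degree, SimpleGraph.neighborFinset_eq_filter]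

lemma sum_sum_uniformDemand (hm : 0 < G.edgeFinset.card) :
    ∑ u, ∑ v, uniformDemand G u v = 1 := by
  simp_rw [sum_uniformDemand]
  rw [← Finset.sum_mul, ← Nat.cast_sum, SimpleGraph.sum_degrees_eq_twice_card_edges]
  have : (0 : ℝ) < G.edgeFinset.card := by exact_mod_cast hm
  push_cast
  field_simp

lemma EPL_uniformDemand_le (hm : 0 < G.edgeFinset.card) (N : SimpleGraph V) {b : ℝ}
    (hb : ∀ u v, (N.dist u v : ℝ) ≤ b) : EPL (uniformDemand G) N ≤ b := by
  calc EPL (uniformDemand G) N ≤ ∑ u, ∑ v, uniformDemand G u v * b :=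
        Finset.sum_le_sum fun u _ => Finset.sum_le_sum fun v _ =>
          mul_le_mul_of_nonneg_left (hb u v) (uniformDemand_nonneg G u v)
    _ = b := by
        simp_rw [← Finset.sum_mul]
        rw [sum_sum_uniformDemand G hm, one_mul]

lemma le_condHYX_uniformDemand (hm : 0 < G.edgeFinset.card) {b : ℝ}
    (hb : ∀ u, b ≤ Real.logb 2 (G.degree u)) : b ≤ condHYX (uniformDemand G) := by
  calc b = ∑ u, ∑ v, uniformDemand G u v * b := by
        simp_rw [← Finset.sum_mul]
        rw [sum_sum_uniformDemand G hm, one_mul]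
    _ ≤ condHYX (uniformDemand G) := by
        refine Finset.sum_le_sum fun u _ => Finset.sum_le_sum fun v _ => ?_
        split_ifs with h
        · refine mul_le_mul_of_nonneg_left ((hb u).trans_eq ?_) h.le
          rw [sum_uniformDemand]
          have huv : uniformDemand G u v = 1 / (2 * (G.edgeFinset.card : ℝ)) := by
            unfold uniformDemand at h ⊢
            split_ifs at h ⊢ with hadj
            · rfl
            · exact absurd h (lt_irrefl _)
          rw [← huv, mul_div_assoc, div_self h.ne', mul_one]
        · rw [le_antisymm (not_lt.mp h) (uniformDemand_nonneg G u v), zero_mul]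

end UniformDemand

theorem stmt_8 :
    ∃ a : ℝ, 0 < a ∧
      ∀ (c : ℝ), 1 ≤ c → ∀ (Δ : ℕ), 2 ≤ Δ →
        ∀ (V : Type) [Fintype V] [DecidableEq V] [Nonempty V],
          2 ≤ Fintype.card V →
          ∀ G : SimpleGraph V,
            ((Fintype.card V : ℝ) ^ ((1 : ℝ) / c)) ≤ (G.minDegree : ℝ) →
            ∃ N : SimpleGraph V, N.maxDegree ≤ Δ + 1 ∧
              (∀ u v, G.Adj u v → N.Reachable u v) ∧
              EPL (uniformDemand G) N ≤
                a * c * (condHYX (uniformDemand G) / Real.logb 2 (Δ : ℝ) + 1) := by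
  refine ⟨2, two_pos, fun c hc Δ hΔ V _ _ _ hV G hmin => ?_⟩
  have hn : (0 : ℝ) < Fintype.card V := by positivity
  have hpow : (0 : ℝ) < (Fintype.card V : ℝ) ^ ((1 : ℝ) / c) := Real.rpow_pos_of_pos hn _
  have hdeg : ∀ u, (Fintype.card V : ℝ) ^ ((1 : ℝ) / c) ≤ (G.degree u : ℝ) := fun u =>
    hmin.trans (by exact_mod_cast G.minDegree_le_degree u)
  have hm : 0 < G.edgeFinset.card := by
    obtain ⟨u⟩ := ‹Nonempty V›
    have hu : 0 < G.degree u := by exact_mod_cast hpow.trans_le (hdeg u)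
    obtain ⟨v, hv⟩ := (G.degree_pos_iff_exists_adj u).mp hu
    exact Finset.card_pos.mpr ⟨s(u, v), SimpleGraph.mem_edgeFinset.mpr hv⟩
  have hH : 1 / c * Real.logb 2 (Fintype.card V) ≤ condHYX (uniformDemand G) := by
    refine le_condHYX_uniformDemand G hm fun u => ?_
    rw [← Real.logb_rpow_eq_mul_logb_of_pos hn]
    exact Real.logb_le_logb_of_le one_lt_two hpow (hdeg u)
  have hD : 0 < Real.logb 2 (Δ : ℝ) :=
    Real.logb_pos one_lt_two (by exact_mod_cast hΔ)
  obtain ⟨N, hN, hdist⟩ := exists_simpleGraph_maxDegree_le_dist_le V (Δ := Δ) (by omega)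
    (Nat.lt_pow_succ_log_self (by omega) (Fintype.card V)).le
  refine ⟨N, hN, fun u v _ => (hdist u v).1, ?_⟩
  have hEPL : EPL (uniformDemand G) N ≤ 2 * ((Nat.log Δ (Fintype.card V) : ℝ) + 1) :=
    EPL_uniformDemand_le G hm N fun u v => by exact_mod_cast (hdist u v).2
  have hlog : (Nat.log Δ (Fintype.card V) : ℝ) ≤
      Real.logb 2 (Fintype.card V) / Real.logb 2 (Δ : ℝ) := by
    rw [le_div_iff₀ hD, ← Real.logb_pow]
    refine Real.logb_le_logb_of_le one_lt_two (by positivity) ?_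
    exact_mod_cast Nat.pow_log_le_self Δ (by omega)
  have hc0 : 0 < c := by linarith
  have hcH : Real.logb 2 (Fintype.card V) ≤ c * condHYX (uniformDemand G) := by
    rwa [one_div_mul_eq_div, div_le_iff₀' hc0] at hH
  have hquot : Real.logb 2 (Fintype.card V) / Real.logb 2 (Δ : ℝ) ≤
      c * (condHYX (uniformDemand G) / Real.logb 2 (Δ : ℝ)) := by
    rw [← mul_div_assoc]
    gcongr
  linarith
end

section
/- For every natural number λ ≥ 1 there exist constants Δ₀ and c > 0 such that the following holds. Let V be a finite vertex set, r ≥ 2, and let G be a connected r-regular simple graph on V with λ-locally bounded doubling dimension, and let p be the uniform demand on G. Then there exists a simple graph N on V with maximum degree at most Δ₀ such that every pair adjacent in G is reachable in N and EPL(p, N) ≤ c · log₂ r. -/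
open Finset SimpleGraph Real

attribute [local instance] Classical.propDecidable

/-- `G` has `lam`-locally bounded doubling dimension: the 2-ball around any vertex is
covered by at most `lam` 1-balls. -/
def LocallyDoubling {V : Type} [Fintype V] [DecidableEq V]
    (G : SimpleGraph V) (lam : ℕ) : Prop :=
  ∀ u : V, ∃ s : Finset V, s.card ≤ lam ∧
    ∀ w : V, G.dist u w ≤ 2 → ∃ y ∈ s, G.dist y w ≤ 1

theorem SimpleGraph.Connected.exists_dist_le_of_dist_le_succ {V : Type} {G : SimpleGraph V}
    (hG : G.Connected) {u w : V} {k : ℕ} (h : G.dist u w ≤ k + 1) :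
    ∃ x, G.dist u x ≤ k ∧ G.dist x w ≤ 1 := by
  obtain ⟨p, hp⟩ := (hG w u).exists_walk_length_eq_dist
  cases p with
  | nil => exact ⟨u, by simp, by simp⟩
  | @cons _ x _ hadj q =>
    refine ⟨x, ?_, (dist_eq_one_iff_adj.2 hadj.symm).le⟩
    have hq := dist_le q
    rw [Walk.length_cons, dist_comm] at hp
    rw [dist_comm]
    omega

theorem LocallyDoubling.exists_cover_ball {V : Type} [Fintype V] [DecidableEq V]
    {G : SimpleGraph V} {lam : ℕ}
    (hG : G.Connected) (hd : LocallyDoubling G lam) (k : ℕ) (u : V) :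
    ∃ t : Finset V, t.card ≤ lam ^ k ∧
      ∀ w, G.dist u w ≤ k + 1 → ∃ y ∈ t, G.dist y w ≤ 1 := by
  induction k with
  | zero => exact ⟨{u}, by simp, fun w hw => ⟨u, by simp, by simpa using hw⟩⟩
  | succ k ih =>
    obtain ⟨t, ht, hcov⟩ := ih
    choose s hs hscov using hd
    refine ⟨t.biUnion s, ?_, fun w hw => ?_⟩
    · calc (t.biUnion s).card ≤ t.card * lam := card_biUnion_le_card_mul _ _ _ fun y _ => hs y
        _ ≤ lam ^ k * lam := Nat.mul_le_mul_right _ ht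
        _ = lam ^ (k + 1) := (pow_succ _ _).symm
    · obtain ⟨x, hux, hxw⟩ := hG.exists_dist_le_of_dist_le_succ hw
      obtain ⟨y, hy, hyx⟩ := hcov x hux
      obtain ⟨z, hz, hzw⟩ := hscov y w ((hG.dist_triangle (v := x)).trans (by omega))
      exact ⟨z, mem_biUnion.2 ⟨y, hy, hz⟩, hzw⟩

theorem LocallyDoubling.card_le_of_dist_le_two {V : Type} [Fintype V] [DecidableEq V]
    {G : SimpleGraph V} {lam r : ℕ}
    (hG : G.Connected) (hd : LocallyDoubling G lam) (hr : ∀ v, G.degree v = r) {u : V}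
    {C : Finset V} (hC : ∀ v ∈ C, G.dist u v ≤ 2) : C.card ≤ lam * (r + 1) := by
  obtain ⟨s, hs, hcov⟩ := hd u
  have hsub : C ⊆ s.biUnion fun y => insert y (G.neighborFinset y) := fun v hv => by
    obtain ⟨y, hy, hyv⟩ := hcov v (hC v hv)
    refine mem_biUnion.2 ⟨y, hy, ?_⟩
    rcases Nat.le_one_iff_eq_zero_or_eq_one.1 hyv with h | h
    · simp [(hG y v).dist_eq_zero_iff.1 h]
    · simp [dist_eq_one_iff_adj.1 h]
  calc C.card ≤ _ := card_le_card hsub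
    _ ≤ s.card * (r + 1) := card_biUnion_le_card_mul _ _ _ fun y _ => by
        refine (card_insert_le _ _).trans ?_
        rw [card_neighborFinset_eq_degree, hr]
    _ ≤ lam * (r + 1) := Nat.mul_le_mul_right _ hs

theorem LocallyDoubling.card_le_of_separated {V : Type} [Fintype V] [DecidableEq V]
    {G : SimpleGraph V} {lam k : ℕ}
    (hG : G.Connected) (hd : LocallyDoubling G lam) {u : V} {T : Finset V}
    (hsep : ∀ x ∈ T, ∀ y ∈ T, x ≠ y → 2 < G.dist x y)
    (hT : ∀ x ∈ T, G.dist u x ≤ k + 1) : T.card ≤ lam ^ k := by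
  obtain ⟨t, ht, hcov⟩ := hd.exists_cover_ball hG k u
  refine le_trans (card_le_card_of_forall_subsingleton (fun x y => G.dist y x ≤ 1)
    (fun x hx => hcov x (hT x hx)) fun y _ a ha b hb => ?_) ht
  by_contra hab
  have h1 := hsep a ha.1 b hb.1 hab
  have h2 := hG.dist_triangle (u := a) (v := y) (w := b)
  have h3 : G.dist y a ≤ 1 := ha.2
  have h4 : G.dist y b ≤ 1 := hb.2
  rw [dist_comm] at h3
  omega

/-- A maximal `2`-separated set is a `2`-net. -/
theorem SimpleGraph.exists_net_dist_two {V : Type} [Fintype V]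
    (G : SimpleGraph V) :
    ∃ S : Finset V, (∀ x ∈ S, ∀ y ∈ S, x ≠ y → 2 < G.dist x y) ∧
      ∀ v, ∃ x ∈ S, G.dist x v ≤ 2 := by
  obtain ⟨S, hS⟩ := (Set.toFinite
    {S : Finset V | ∀ x ∈ S, ∀ y ∈ S, x ≠ y → 2 < G.dist x y}).exists_maximal ⟨∅, by simp⟩
  refine ⟨S, hS.prop, fun v => ?_⟩
  by_contra! hv
  have hmem : insert v S ∈ {S : Finset V | ∀ x ∈ S, ∀ y ∈ S, x ≠ y → 2 < G.dist x y} := by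
    intro x hx y hy hxy
    rcases mem_insert.1 hx with rfl | hxS <;> rcases mem_insert.1 hy with rfl | hyS
    · exact absurd rfl hxy
    · rw [dist_comm]; exact hv y hyS
    · exact hv x hxS
    · exact hS.prop x hxS y hyS hxy
  have hvS : v ∈ S := hS.le_of_ge hmem (subset_insert v S) (mem_insert_self v S)
  simpa using hv v hvS

/-- An enumeration of each fibre of `σ` by an initial segment of the natural numbers. -/
theorem exists_fiber_index {V : Type} [Fintype V] [DecidableEq V]
    (σ : V → V) :
    ∃ idx : V → ℕ, (∀ u v, σ u = σ v → idx u = idx v → u = v) ∧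
      (∀ v, idx v < (univ.filter fun w => σ w = σ v).card) ∧
      ∀ v i, i ≤ idx v → ∃ w, σ w = σ v ∧ idx w = i := by
  let e := fun c => (univ.filter fun w => σ w = c).equivFin
  have he : ∀ c v (h : σ v = c), (e (σ v) ⟨v, by simp⟩ : ℕ) = e c ⟨v, by simp [h]⟩ := by
    rintro c v rfl; rfl
  refine ⟨fun v => e (σ v) ⟨v, by simp⟩, fun u v h hi => ?_, fun v => Fin.isLt _,
    fun v i hi => ?_⟩
  · dsimp only at hi
    rw [he _ u h, Fin.val_inj, (e (σ v)).apply_eq_iff_eq] at hi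
    exact congrArg Subtype.val hi
  · have hlt := hi.trans_lt (e (σ v) ⟨v, by simp⟩).isLt
    have hw : σ ((e (σ v)).symm ⟨i, hlt⟩) = σ v := 
      (mem_filter.1 ((e (σ v)).symm ⟨i, hlt⟩).2).2
    refine ⟨(e (σ v)).symm ⟨i, hlt⟩, hw, ?_⟩
    dsimp only
    rw [he _ _ hw]
    simp

/-- Each fibre of `σ` carries a binary tree, in which index `i` has parent `i / 2`; roots of
fibres are joined according to `R`. -/
def treeNetwork {V : Type} (σ : V → V) (idx : V → ℕ) (R : V → V → Prop) : SimpleGraph V :=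
  SimpleGraph.fromRel fun u v =>
    (σ u = σ v ∧ idx v = idx u / 2) ∨ (idx u = 0 ∧ idx v = 0 ∧ R (σ u) (σ v))

theorem exists_walk_root_treeNetwork {V : Type} {σ : V → V} {idx : V → ℕ} {R : V → V → Prop}
    (hsurj : ∀ v i, i ≤ idx v → ∃ w, σ w = σ v ∧ idx w = i) (k : ℕ) (v : V)
    (hv : idx v < 2 ^ k) :
    ∃ ρ, σ ρ = σ v ∧ idx ρ = 0 ∧ ∃ p : (treeNetwork σ idx R).Walk v ρ, p.length ≤ k := by
  induction k generalizing v with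
  | zero => exact ⟨v, rfl, by simpa using hv, Walk.nil, le_rfl⟩
  | succ k ih =>
    by_cases h0 : idx v = 0
    · exact ⟨v, rfl, h0, Walk.nil, by simp⟩
    obtain ⟨w, hw, hwi⟩ := hsurj v (idx v / 2) (Nat.div_le_self _ _)
    obtain ⟨ρ, hρ, hρ0, p, hp⟩ := ih w (by rw [pow_succ] at hv; omega)
    have hadj : (treeNetwork σ idx R).Adj v w := by
      refine (fromRel_adj _ _ _).2 ⟨?_, Or.inl (Or.inl ⟨hw.symm, hwi⟩)⟩
      rintro rfl
      omega
    exact ⟨ρ, hρ.trans hw, hρ0, Walk.cons hadj p, by simpa using hp⟩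

theorem exists_walk_treeNetwork {V : Type} {σ : V → V} {idx : V → ℕ} {R : V → V → Prop}
    (hsurj : ∀ v i, i ≤ idx v → ∃ w, σ w = σ v ∧ idx w = i) {k : ℕ}
    (hk : ∀ v, idx v < 2 ^ k) {u v : V} (huv : R (σ u) (σ v)) :
    ∃ p : (treeNetwork σ idx R).Walk u v, p.length ≤ 2 * k + 1 := by
  obtain ⟨a, ha, ha0, p, hp⟩ := exists_walk_root_treeNetwork (R := R) hsurj k u (hk u)
  obtain ⟨b, hb, hb0, q, hq⟩ := exists_walk_root_treeNetwork (R := R) hsurj k v (hk v)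
  by_cases hab : a = b
  · subst hab
    refine ⟨p.append q.reverse, ?_⟩
    rw [Walk.length_append, Walk.length_reverse]
    omega
  · have hadj : (treeNetwork σ idx R).Adj a b :=
      (fromRel_adj _ _ _).2 ⟨hab, Or.inl (Or.inr ⟨ha0, hb0, by rwa [ha, hb]⟩)⟩
    refine ⟨p.append (Walk.cons hadj q.reverse), ?_⟩
    rw [Walk.length_append, Walk.length_cons, Walk.length_reverse]
    omega

theorem degree_treeNetwork_le {V : Type} [Fintype V] [DecidableEq V]
    {σ : V → V} {idx : V → ℕ} {R : V → V → Prop} {D : ℕ}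
    (hinj : ∀ u v, σ u = σ v → idx u = idx v → u = v) (hR : ∀ a b, R a b → R b a)
    (u : V) (hD : ((univ.image σ).filter fun c => R (σ u) c).card ≤ D) :
    (treeNetwork σ idx R).degree u ≤ 3 + D := by
  let A := univ.filter fun v => σ v = σ u ∧
    idx v ∈ ({idx u / 2, 2 * idx u, 2 * idx u + 1} : Finset ℕ)
  let B := univ.filter fun v => idx v = 0 ∧ R (σ u) (σ v)
  have hsub : (treeNetwork σ idx R).neighborFinset u ⊆ A ∪ B := by
    intro v hv
    rw [mem_neighborFinset, treeNetwork, fromRel_adj] at hv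
    simp only [A, B, mem_union, mem_filter, mem_univ, true_and, mem_insert, mem_singleton]
    rcases hv.2 with (⟨h1, h2⟩ | ⟨h1, h2, h3⟩) | (⟨h1, h2⟩ | ⟨h1, h2, h3⟩)
    · exact Or.inl ⟨h1.symm, Or.inl h2⟩
    · exact Or.inr ⟨h2, h3⟩
    · exact Or.inl ⟨h1, by omega⟩
    · exact Or.inr ⟨h1, hR _ _ h3⟩
  have hA : A.card ≤ 3 := by
    refine (card_le_card_of_injOn idx (fun v hv => (mem_filter.1 hv).2.2) ?_).trans card_le_three
    intro v hv w hw h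
    exact hinj v w ((mem_filter.1 hv).2.1.trans (mem_filter.1 hw).2.1.symm) h
  have hB : B.card ≤ D := by
    refine (card_le_card_of_injOn σ (fun v hv => ?_) ?_).trans hD
    · exact mem_filter.2 ⟨mem_image_of_mem σ (mem_univ v), (mem_filter.1 hv).2.2⟩
    · intro v hv w hw h
      exact hinj v w h ((mem_filter.1 hv).2.1.trans (mem_filter.1 hw).2.1.symm)
  rw [← card_neighborFinset_eq_degree]
  calc _ ≤ (A ∪ B).card := card_le_card hsub
    _ ≤ A.card + B.card := card_union_le _ _
    _ ≤ 3 + D := Nat.add_le_add hA hB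

theorem sum_uniformDemand_le_one {V : Type} [Fintype V] [DecidableEq V]
    (G : SimpleGraph V) :
    ∑ u, ∑ v, uniformDemand G u v ≤ 1 := by
  have h : ∀ u, ∑ v, uniformDemand G u v
      = (G.degree u : ℝ) * (1 / (2 * (G.edgeFinset.card : ℝ))) := fun u => by
    simp only [uniformDemand]
    rw [← sum_filter, sum_const, nsmul_eq_mul, ← card_neighborFinset_eq_degree,
      neighborFinset_eq_filter]
  rw [sum_congr rfl fun u _ => h u, ← sum_mul, ← Nat.cast_sum,
    G.sum_degrees_eq_twice_card_edges, Nat.cast_mul, Nat.cast_ofNat, mul_one_div]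
  exact div_self_le_one _

theorem EPL_uniformDemand_le_s10 {V : Type} [Fintype V] [DecidableEq V]
    {G N : SimpleGraph V} {B : ℝ} (hB : 0 ≤ B)
    (h : ∀ u v, G.Adj u v → (N.dist u v : ℝ) ≤ B) : EPL (uniformDemand G) N ≤ B := by
  calc EPL (uniformDemand G) N ≤ ∑ u, ∑ v, uniformDemand G u v * B := by
        refine sum_le_sum fun u _ => sum_le_sum fun v _ => ?_
        unfold uniformDemand
        split_ifs with huv
        · exact mul_le_mul_of_nonneg_left (h u v huv) (by positivity)
        · simp
    _ = (∑ u, ∑ v, uniformDemand G u v) * B := by simp only [sum_mul]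
    _ ≤ 1 * B := mul_le_mul_of_nonneg_right (sum_uniformDemand_le_one G) hB
    _ = B := one_mul B

theorem stmt_10 (lam : ℕ) (hlam : 1 ≤ lam) :
    ∃ (Δ₀ : ℕ) (c : ℝ), 0 < c ∧
      ∀ (V : Type) [Fintype V] [DecidableEq V] (r : ℕ), 2 ≤ r →
        ∀ G : SimpleGraph V, G.Connected → (∀ v, G.degree v = r) →
          LocallyDoubling G lam →
          ∃ N : SimpleGraph V, N.maxDegree ≤ Δ₀ ∧
            (∀ u v, G.Adj u v → N.Reachable u v) ∧
            EPL (uniformDemand G) N ≤ c * Real.logb 2 (r : ℝ) := by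
  refine ⟨3 + lam ^ 4, 2 * lam + 5, by positivity, ?_⟩
  intro V _ _ r hr G hG hreg hd
  obtain ⟨S, hsep, hnet⟩ := G.exists_net_dist_two
  choose σ hσS hσ using hnet
  obtain ⟨idx, hinj, hlt, hsurj⟩ := exists_fiber_index σ
  let k := lam + (Nat.log 2 r + 1)
  have hk : ∀ v, idx v < 2 ^ k := fun v => by
    have hcard : (univ.filter fun w => σ w = σ v).card ≤ lam * (r + 1) :=
      hd.card_le_of_dist_le_two hG hreg (u := σ v) fun w hw => by
        rw [← (mem_filter.1 hw).2]; exact hσ w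
    calc idx v < lam * (r + 1) := (hlt v).trans_le hcard
      _ ≤ 2 ^ lam * 2 ^ (Nat.log 2 r + 1) :=
        Nat.mul_le_mul Nat.lt_two_pow_self.le (Nat.lt_pow_succ_log_self one_lt_two r)
      _ = 2 ^ k := (pow_add _ _ _).symm
  obtain ⟨R, hR⟩ : ∃ R : V → V → Prop, ∀ a b, R a b ↔ G.dist a b ≤ 5 := ⟨_, fun _ _ => Iff.rfl⟩
  have hwalk : ∀ u v, G.Adj u v →
      ∃ p : (treeNetwork σ idx R).Walk u v, p.length ≤ 2 * k + 1 := fun u v huv => by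
    refine exists_walk_treeNetwork hsurj hk ((hR _ _).2 ?_)
    have h1 := hσ u
    have h2 := hσ v
    have h3 := dist_eq_one_iff_adj.2 huv
    have h4 := hG.dist_triangle (u := σ u) (v := u) (w := σ v)
    have h5 := hG.dist_triangle (u := u) (v := v) (w := σ v)
    rw [SimpleGraph.dist_comm] at h2
    omega
  have hL : 1 ≤ Real.logb 2 (r : ℝ) := by
    rw [Real.le_logb_iff_rpow_le one_lt_two (by positivity)]
    simpa using (by exact_mod_cast hr : (2 : ℝ) ≤ r)
  have hlog : (Nat.log 2 r : ℝ) ≤ Real.logb 2 (r : ℝ) := by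
    simpa using Real.natLog_le_logb r 2
  refine ⟨treeNetwork σ idx R, ?_, fun u v huv => (hwalk u v huv).elim fun p _ => p.reachable,
    EPL_uniformDemand_le_s10 (by positivity) fun u v huv => ?_⟩
  · refine maxDegree_le_of_forall_degree_le _ _ fun u => degree_treeNetwork_le hinj
      (fun a b h => by rwa [hR, SimpleGraph.dist_comm, ← hR]) u ?_
    refine hd.card_le_of_separated hG (u := σ u) (fun x hx y hy => hsep x ?_ y ?_)
      fun x hx => (hR _ _).1 (mem_filter.1 hx).2
    · obtain ⟨w, -, rfl⟩ := mem_image.1 (mem_filter.1 hx).1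
      exact hσS w
    · obtain ⟨w, -, rfl⟩ := mem_image.1 (mem_filter.1 hy).1
      exact hσS w
  · obtain ⟨p, hp⟩ := hwalk u v huv
    have hdist : ((treeNetwork σ idx R).dist u v : ℝ) ≤ 2 * (lam + (Nat.log 2 r + 1)) + 1 := by
      exact_mod_cast (dist_le p).trans hp
    have hlam0 : (0 : ℝ) ≤ lam := Nat.cast_nonneg lam
    nlinarith
end

section
/- Let G be a connected simple graph on a finite vertex set V with n = |V|, and suppose G has λ-locally bounded doubling dimension for a natural number λ ≥ 1. Then there exists a simple graph S with S ≤ G (a subgraph spanner on the same vertex set) such that S has at most (2 + λ⁴) · n edges and, for every pair u, v adjacent in G, u and v are reachable in S and d_S(u, v) ≤ 9. -/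
open Finset SimpleGraph Real

attribute [local instance] Classical.propDecidable

/-- In a connected locally doubling graph, every ball of radius `r + 2` is covered by
`lam ^ (r + 1)` balls of radius `1`. -/
theorem LocallyDoubling.exists_cover {V : Type} [Fintype V] [DecidableEq V]
    {G : SimpleGraph V} (hG : G.Connected) {lam : ℕ} (hdd : LocallyDoubling G lam)
    (u : V) (r : ℕ) :
    ∃ s : Finset V, s.card ≤ lam ^ (r + 1) ∧
      ∀ w : V, G.dist u w ≤ r + 2 → ∃ y ∈ s, G.dist y w ≤ 1 := by
  induction r with
  | zero => simpa using hdd u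
  | succ r ih =>
    obtain ⟨s, hs, hcov⟩ := ih
    choose t ht htcov using hdd
    refine ⟨s.biUnion t, ?_, fun w hw => ?_⟩
    · calc (s.biUnion t).card ≤ s.card * lam := card_biUnion_le_card_mul _ _ _ fun x _ => ht x
        _ ≤ lam ^ (r + 1) * lam := by gcongr
        _ = lam ^ (r + 1 + 1) := (pow_succ _ _).symm
    · obtain ⟨w', hw', hww'⟩ : ∃ w', G.dist u w' ≤ r + 2 ∧ G.dist w' w ≤ 1 := by
        obtain ⟨p, hp⟩ := hG.exists_walk_length_eq_dist u w
        refine ⟨p.getVert (r + 2), (dist_le (p.take (r + 2))).trans ?_,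
          (dist_le (p.drop (r + 2))).trans ?_⟩
        · simp [Walk.take_length]
        · rw [Walk.drop_length]
          omega
      obtain ⟨y, hy, hyw⟩ := hcov w' hw'
      have := hG.dist_triangle (u := y) (v := w') (w := w)
      obtain ⟨z, hz, hzw⟩ := htcov y w (by omega)
      exact ⟨z, mem_biUnion.2 ⟨y, hy, hz⟩, hzw⟩

/-- A set of vertices at pairwise distance at least `3` is no larger than any family of
balls of radius `1` covering it. -/
theorem SimpleGraph.card_le_card_of_separated {V : Type} {G : SimpleGraph V}
    (hG : G.Connected) {A s : Finset V}
    (hA : ∀ x ∈ A, ∀ y ∈ A, G.dist x y ≤ 2 → x = y)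
    (hs : ∀ w ∈ A, ∃ y ∈ s, G.dist y w ≤ 1) : A.card ≤ s.card := by
  choose! f hf hfd using hs
  refine card_le_card_of_injOn f hf fun x hx y hy hxy => hA x hx y hy ?_
  have h₁ := hfd x hx
  have h₂ := hfd y hy
  rw [← hxy] at h₂
  rw [dist_comm] at h₁
  have := hG.dist_triangle (u := x) (v := f x) (w := y)
  omega

/-- A finite graph has a set of vertices at pairwise distance at least `3` such that every
vertex is within distance `2` of it. -/
theorem SimpleGraph.exists_separated_net {V : Type} [Fintype V] (G : SimpleGraph V) :
    ∃ N : Finset V, (∀ x ∈ N, ∀ y ∈ N, G.dist x y ≤ 2 → x = y) ∧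
      ∀ v, ∃ c ∈ N, G.dist v c ≤ 2 := by
  obtain ⟨N, hN⟩ := (Set.toFinite
    {N : Finset V | ∀ x ∈ N, ∀ y ∈ N, G.dist x y ≤ 2 → x = y}).exists_maximal
    ⟨∅, by simp⟩
  refine ⟨N, hN.prop, fun v => ?_⟩
  by_contra! hv
  have hins : insert v N ∈ {N : Finset V | ∀ x ∈ N, ∀ y ∈ N, G.dist x y ≤ 2 → x = y} := by
    intro x hx y hy hxy
    rw [mem_insert] at hx hy
    rcases hx with rfl | hx <;> rcases hy with rfl | hy
    · rfl
    · exact absurd hxy (not_le.2 (hv y hy))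
    · exact absurd (dist_comm (G := G) ▸ hxy) (not_le.2 (hv x hx))
    · exact hN.prop x hx y hy hxy
  have := hv v (hN.le_of_ge hins (subset_insert v N) (mem_insert_self v N))
  simp at this

/-- Vertices at distance at most `2` have a common closed neighbour. -/
theorem SimpleGraph.Connected.exists_mid_of_dist_le_two {V : Type} {G : SimpleGraph V}
    (hG : G.Connected) {v c : V} (h : G.dist v c ≤ 2) :
    ∃ m, (v = m ∨ G.Adj v m) ∧ (m = c ∨ G.Adj m c) := by
  obtain ⟨p, hp⟩ := hG.exists_walk_length_eq_dist v c
  rw [← hp] at h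
  match p, h with
  | .nil, _ => exact ⟨v, .inl rfl, .inl rfl⟩
  | .cons h₁ .nil, _ => exact ⟨_, .inr h₁, .inl rfl⟩
  | .cons h₁ (.cons h₂ .nil), _ => exact ⟨_, .inr h₁, .inr h₂⟩
  | .cons _ (.cons _ (.cons _ _)), h => simp at h

theorem stmt_11 {V : Type} [Fintype V] [DecidableEq V]
    (G : SimpleGraph V) (hG : G.Connected)
    (lam : ℕ) (hlam : 1 ≤ lam) (hdd : LocallyDoubling G lam) :
    ∃ S : SimpleGraph V, S ≤ G ∧
      S.edgeFinset.card ≤ (2 + lam ^ 4) * Fintype.card V ∧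
      ∀ u v, G.Adj u v → S.Reachable u v ∧ S.dist u v ≤ 9 := by
  obtain ⟨N, hsep, hnet⟩ := G.exists_separated_net
  choose c hcN hc using hnet
  choose m hm₁ hm₂ using fun v => hG.exists_mid_of_dist_le_two (hc v)
  let P : Finset (V × V) := univ.filter fun p => ∃ u v, G.Adj u v ∧ c u = p.1 ∧ c v = p.2
  have hP : ∀ p ∈ P, ∃ e : V × V, G.Adj e.1 e.2 ∧ c e.1 = p.1 ∧ c e.2 = p.2 := by
    intro p hp
    obtain ⟨u, v, h⟩ := (mem_filter.1 hp).2
    exact ⟨(u, v), h⟩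
  choose! f hfadj hf₁ hf₂ using hP
  have hPcard : P.card ≤ lam ^ 4 * Fintype.card V := by
    refine card_le_mul_card_image_of_maps_to (f := Prod.fst) (t := univ) (fun _ _ => mem_univ _) _ ?_
    intro a _
    obtain ⟨s, hs, hcov⟩ := hdd.exists_cover hG a 3
    have hle : (P.filter fun p => p.1 = a).card ≤ (N.filter fun b => G.dist a b ≤ 5).card := by
      refine card_le_card_of_injOn Prod.snd ?_ ?_
      · rintro ⟨x, y⟩ hp
        simp only [P, coe_filter, mem_filter, mem_univ, true_and, Set.mem_ofPred_eq] at hp ⊢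
        obtain ⟨⟨u, v, huv, rfl, rfl⟩, rfl⟩ := hp
        refine ⟨hcN v, ?_⟩
        have h₁ := hc u
        rw [dist_comm] at h₁
        have h₂ := hc v
        have h₃ := dist_eq_one_iff_adj.2 huv
        have h₄ := hG.dist_triangle (u := c u) (v := u) (w := v)
        have h₅ := hG.dist_triangle (u := c u) (v := v) (w := c v)
        omega
      · rintro ⟨x, y⟩ hx ⟨x', y'⟩ hy h
        simp only [coe_filter, Set.mem_ofPred_eq] at hx hy h
        rw [hx.2, hy.2, h]
    refine hle.trans ((SimpleGraph.card_le_card_of_separated hG ?_ ?_).trans hs)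
    · exact fun x hx y hy => hsep x (mem_filter.1 hx).1 y (mem_filter.1 hy).1
    · exact fun w hw => hcov w (mem_filter.1 hw).2
  let E : Finset (Sym2 V) := univ.image (fun v => s(v, m v)) ∪
    univ.image (fun v => s(m v, c v)) ∪ P.image fun p => s((f p).1, (f p).2)
  obtain ⟨S, hSdef⟩ : ∃ S, S = fromEdgeSet E ⊓ G := ⟨_, rfl⟩
  have hS : ∀ {x y}, s(x, y) ∈ E → G.Adj x y → S.Adj x y := fun h h' =>
    hSdef ▸ ⟨(fromEdgeSet_adj _).2 ⟨h, h'.ne⟩, h'⟩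
  have hwalk : ∀ v, ∃ p : S.Walk v (c v), p.length ≤ 2 := by
    intro v
    have h₁ : ∃ p : S.Walk v (m v), p.length ≤ 1 := by
      rcases hm₁ v with h | h
      · exact ⟨Walk.nil.copy rfl h, by simp⟩
      · exact ⟨(hS (mem_union_left _ (mem_union_left _ (mem_image_of_mem _ (mem_univ v)))) h).toWalk,
          by simp⟩
    have h₂ : ∃ p : S.Walk (m v) (c v), p.length ≤ 1 := by
      rcases hm₂ v with h | h
      · exact ⟨Walk.nil.copy rfl h, by simp⟩
      · exact ⟨(hS (mem_union_left _ (mem_union_right _ (mem_image_of_mem _ (mem_univ v)))) h).toWalk,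
          by simp⟩
    obtain ⟨p, hp⟩ := h₁
    obtain ⟨q, hq⟩ := h₂
    exact ⟨p.append q, by rw [Walk.length_append]; omega⟩
  refine ⟨S, hSdef ▸ inf_le_right, ?_, fun u v huv => ?_⟩
  · have hsub : S.edgeFinset ⊆ E := by
      intro e he
      induction e with
      | _ x y =>
        rw [mem_edgeFinset, mem_edgeSet, hSdef] at he
        exact ((fromEdgeSet_adj _).1 he.1).1
    calc S.edgeFinset.card ≤ E.card := card_le_card hsub
      _ ≤ Fintype.card V + Fintype.card V + P.card :=
        (card_union_le _ _).trans (add_le_add ((card_union_le _ _).trans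
          (add_le_add card_image_le card_image_le)) card_image_le)
      _ ≤ (2 + lam ^ 4) * Fintype.card V := by linarith
  · have hp : (c u, c v) ∈ P := mem_filter.2 ⟨mem_univ _, u, v, huv, rfl, rfl⟩
    have hadj : S.Adj (f (c u, c v)).1 (f (c u, c v)).2 :=
      hS (mem_union_right _ (mem_image_of_mem _ hp)) (hfadj _ hp)
    obtain ⟨p₁, h₁⟩ := hwalk u
    obtain ⟨p₂, h₂⟩ := hwalk (f (c u, c v)).1
    obtain ⟨p₃, h₃⟩ := hwalk (f (c u, c v)).2
    obtain ⟨p₄, h₄⟩ := hwalk v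
    let p := p₁.append ((p₂.copy rfl (hf₁ _ hp)).reverse.append
      (hadj.toWalk.append ((p₃.copy rfl (hf₂ _ hp)).append p₄.reverse)))
    refine ⟨p.reachable, (dist_le p).trans ?_⟩
    simp only [p, Walk.length_append, Walk.length_reverse, Walk.length_copy, Adj.length_toWalk]
    omega
end

section
/- For every real M > 0 there exist a finite vertex set V with n = |V| ≥ 2 and connected simple graphs G and S on V (S not necessarily a subgraph of G) such that G has at least one edge and APD(G, S) ≥ M · ND(G, S); that is, the average all-pairs distortion can be arbitrarily larger than the average neighborhood distortion. -/
open Finset SimpleGraph Real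

attribute [local instance] Classical.propDecidable

/-- Average all-pairs distortion of `S` with respect to `G`:
`(1/(n choose 2)) · ∑_{unordered pairs {u,v}, u ≠ v} d_S(u,v)/d_G(u,v)`
(each unordered pair is counted once; here via ordered pairs with a factor `1/2`). -/
noncomputable def APD {V : Type} [Fintype V] [DecidableEq V] (G S : SimpleGraph V) : ℝ :=
  (1 / ((Fintype.card V).choose 2 : ℝ)) *
    ((1 / 2) * ∑ u, ∑ v, if u ≠ v then (S.dist u v : ℝ) / (G.dist u v : ℝ) else 0)

/-- Average neighborhood distortion of `S` with respect to `G`: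
`(1/|E(G)|) · ∑_{edges {u,v} of G} d_S(u,v)`
(each edge counted once; here via ordered adjacent pairs with a factor `1/2`). -/
noncomputable def ND {V : Type} [Fintype V] [DecidableEq V] (G S : SimpleGraph V) : ℝ :=
  (1 / (G.edgeFinset.card : ℝ)) *
    ((1 / 2) * ∑ u, ∑ v, if G.Adj u v then (S.dist u v : ℝ) else 0)

/-- Distinct vertices are adjacent when their levels under `f` differ by at most one. -/
def levelGraph {V : Type} (f : V → ℕ) : SimpleGraph V where
  Adj u v := u ≠ v ∧ f u ≤ f v + 1 ∧ f v ≤ f u + 1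
  symm := ⟨fun _ _ h => ⟨h.1.symm, h.2.2, h.2.1⟩⟩
  loopless := ⟨fun _ h => h.1 rfl⟩

/-- Distinct vertices are adjacent when they have the same level or one of them is the hub `c`. -/
def hubGraph {V : Type} (f : V → ℕ) (c : V) : SimpleGraph V where
  Adj u v := u ≠ v ∧ (u = c ∨ v = c ∨ f u = f v)
  symm := ⟨fun _ _ h => ⟨h.1.symm, by rcases h.2 with h | h | h <;> simp [h]⟩⟩
  loopless := ⟨fun _ h => h.1 rfl⟩

theorem levelGraph_le_add_length {V : Type} (f : V → ℕ) {u v : V}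
    (p : (levelGraph f).Walk u v) : f v ≤ f u + p.length := by
  induction p with
  | nil => simp
  | cons h p ih =>
    have := h.2.2
    simp only [Walk.length_cons]
    omega

theorem levelGraph_le_add_dist {V : Type} (f : V → ℕ) (h : (levelGraph f).Connected) (u v : V) :
    f v ≤ f u + (levelGraph f).dist u v := by
  obtain ⟨p, hp⟩ := h.exists_walk_length_eq_dist u v
  exact hp ▸ levelGraph_le_add_length f p

theorem levelGraph_dist_le_one {V : Type} (f : V → ℕ) {u v : V} (h : f u = f v) :
    (levelGraph f).dist u v ≤ 1 := by
  by_cases huv : u = v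
  · simp [huv]
  · exact (dist_eq_one_iff_adj.2 (show (levelGraph f).Adj u v from
      ⟨huv, by omega, by omega⟩)).le

theorem levelGraph_sub_connected {n k : ℕ} (hn : 0 < n) :
    (levelGraph fun v : Fin n => (v : ℕ) - k).Connected := by
  have reach : ∀ (i : ℕ) (hi : i < n),
      (levelGraph fun v : Fin n => (v : ℕ) - k).Reachable ⟨0, hn⟩ ⟨i, hi⟩ := by
    intro i
    induction i with
    | zero => exact fun _ => Reachable.refl _
    | succ i ih =>
      intro hi
      refine (ih (by omega)).trans (Adj.reachable ⟨?_, ?_, ?_⟩)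
      · simp
      · dsimp only; omega
      · dsimp only; omega
  have : Nonempty (Fin n) := ⟨⟨0, hn⟩⟩
  exact ⟨fun u v => (reach u u.2).symm.trans (reach v v.2)⟩

theorem hubGraph_reachable {V : Type} (f : V → ℕ) (c v : V) : (hubGraph f c).Reachable c v := by
  by_cases h : c = v
  · exact h ▸ .rfl
  · exact Adj.reachable ⟨h, .inl rfl⟩

theorem hubGraph_connected {V : Type} (f : V → ℕ) (c : V) : (hubGraph f c).Connected := by
  have : Nonempty V := ⟨c⟩
  exact ⟨fun u v => (hubGraph_reachable f c u).symm.trans (hubGraph_reachable f c v)⟩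

theorem hubGraph_dist_hub_le_one {V : Type} (f : V → ℕ) (c v : V) :
    (hubGraph f c).dist c v ≤ 1 := by
  by_cases h : c = v
  · simp [h]
  · exact (dist_eq_one_iff_adj.2 (show (hubGraph f c).Adj c v from ⟨h, .inl rfl⟩)).le

theorem hubGraph_dist_le_two {V : Type} (f : V → ℕ) (c u v : V) :
    (hubGraph f c).dist u v ≤ 2 := by
  have h := (hubGraph_connected f c).dist_triangle (u := u) (v := c) (w := v)
  have h₁ := hubGraph_dist_hub_le_one f c v
  have h₂ := hubGraph_dist_hub_le_one f c u
  rw [dist_comm] at h₂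
  omega

theorem dist_le_card {V : Type} [Fintype V] {S : SimpleGraph V} (h : S.Connected) (u v : V) :
    S.dist u v ≤ Fintype.card V := by
  obtain ⟨p, hp, hlen⟩ := h.exists_path_of_dist u v
  exact hlen ▸ hp.length_lt.le

/-- A graph containing a clique `s` has at least `(#s choose 2)` edges. -/
theorem card_mul_pred_le_two_mul_card_edgeFinset {V : Type} [Fintype V] [DecidableEq V]
    (G : SimpleGraph V) [Fintype G.edgeSet] (s : Finset V) (hs : G.IsClique s) :
    s.card * (s.card - 1) ≤ 2 * G.edgeFinset.card := by
  have hdeg : ∀ v ∈ s, s.card - 1 ≤ G.degree v := by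
    intro v hv
    rw [← Finset.card_erase_of_mem hv, ← card_neighborFinset_eq_degree]
    refine Finset.card_le_card fun w hw => ?_
    rw [mem_neighborFinset]
    have hw := Finset.mem_erase.1 hw
    exact hs hv hw.2 hw.1.symm
  calc s.card * (s.card - 1) = ∑ _v ∈ s, (s.card - 1) := by simp
    _ ≤ ∑ v ∈ s, G.degree v := Finset.sum_le_sum hdeg
    _ ≤ ∑ v, G.degree v := Finset.sum_le_sum_of_subset (Finset.subset_univ s)
    _ = 2 * G.edgeFinset.card := by convert G.sum_degrees_eq_twice_card_edges

/-- If the pairs in `s ×ˢ t` have distance at most `2` in `G` and at least `d` in `S`, they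
contribute at least `#s * #t * d / 4` to the unnormalised all-pairs distortion. -/
theorem le_APD {V : Type} [Fintype V] [DecidableEq V] {G S : SimpleGraph V} (hG : G.Connected)
    (s t : Finset V) (hst : Disjoint s t) (d : ℕ)
    (h2 : ∀ u ∈ s, ∀ v ∈ t, G.dist u v ≤ 2) (hd : ∀ u ∈ s, ∀ v ∈ t, d ≤ S.dist u v) :
    (1 / ((Fintype.card V).choose 2 : ℝ)) * ((1 / 2) * (s.card * (t.card * (d / 2)))) ≤
      APD G S := by
  unfold APD
  gcongr
  have hnonneg : ∀ u v : V,
      (0 : ℝ) ≤ if u ≠ v then (S.dist u v : ℝ) / (G.dist u v : ℝ) else 0 := by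
    intro u v
    split_ifs <;> positivity
  calc (s.card * (t.card * (d / 2)) : ℝ) = ∑ _u ∈ s, ∑ _v ∈ t, (d / 2 : ℝ) := by simp
    _ ≤ ∑ u ∈ s, ∑ v ∈ t, if u ≠ v then (S.dist u v : ℝ) / (G.dist u v : ℝ) else 0 := by
      refine Finset.sum_le_sum fun u hu => Finset.sum_le_sum fun v hv => ?_
      have huv : u ≠ v := fun h => Finset.disjoint_left.1 hst hu (h ▸ hv)
      rw [if_pos huv]
      have hpos : (0 : ℝ) < G.dist u v := by exact_mod_cast hG.pos_dist_of_ne huv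
      gcongr
      · exact_mod_cast hd u hu v hv
      · exact_mod_cast h2 u hu v hv
    _ ≤ ∑ u ∈ s, ∑ v, if u ≠ v then (S.dist u v : ℝ) / (G.dist u v : ℝ) else 0 :=
      Finset.sum_le_sum fun u _ =>
        Finset.sum_le_sum_of_subset_of_nonneg (Finset.subset_univ t) fun v _ _ => hnonneg u v
    _ ≤ _ := Finset.sum_le_sum_of_subset_of_nonneg (Finset.subset_univ s) fun u _ _ =>
        Finset.sum_nonneg fun v _ => hnonneg u v

theorem ND_hubGraph_levelGraph_le {V : Type} [Fintype V] [DecidableEq V] (f : V → ℕ) (c : V)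
    (hS : (levelGraph f).Connected) :
    ND (hubGraph f c) (levelGraph f) ≤
      (1 / ((hubGraph f c).edgeFinset.card : ℝ)) * ((1 / 2) * (3 * (Fintype.card V : ℝ) ^ 2)) := by
  unfold ND
  gcongr
  calc (∑ u, ∑ v, if (hubGraph f c).Adj u v then ((levelGraph f).dist u v : ℝ) else 0)
      ≤ ∑ u, ∑ v, (1 + (if u = c then (Fintype.card V : ℝ) else 0) +
          (if v = c then (Fintype.card V : ℝ) else 0)) := by
        refine Finset.sum_le_sum fun u _ => Finset.sum_le_sum fun v _ => ?_
        have hn : (0 : ℝ) ≤ Fintype.card V := Nat.cast_nonneg _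
        have hle : ((levelGraph f).dist u v : ℝ) ≤ Fintype.card V := by
          exact_mod_cast dist_le_card hS u v
        by_cases hadj : (hubGraph f c).Adj u v
        · rw [if_pos hadj]
          rcases hadj.2 with h | h | h
          · rw [if_pos h]
            split_ifs <;> linarith
          · rw [if_pos h]
            split_ifs <;> linarith
          · have : ((levelGraph f).dist u v : ℝ) ≤ 1 := by
              exact_mod_cast levelGraph_dist_le_one f h
            split_ifs <;> linarith
        · rw [if_neg hadj]
          positivity
    _ = 3 * (Fintype.card V : ℝ) ^ 2 := by
        simp [Finset.sum_add_distrib]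
        ring

theorem stmt_13 (M : ℝ) (hM : 0 < M) :
    ∃ n : ℕ, 2 ≤ n ∧
      ∃ G S : SimpleGraph (Fin n), G.Connected ∧ S.Connected ∧
        0 < G.edgeFinset.card ∧ APD G S ≥ M * ND G S := by
  obtain ⟨k, hk⟩ := exists_nat_ge (486 * M)
  have hk0 : 0 < k := by
    have : (0 : ℝ) < k := by linarith
    exact_mod_cast this
  set f : Fin (3 * k) → ℕ := fun v => (v : ℕ) - k with hf
  set c : Fin (3 * k) := ⟨0, by omega⟩
  have hS : (levelGraph f).Connected := levelGraph_sub_connected (by omega)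
  have hG := hubGraph_connected f c
  have hedge : (k + 1) * k ≤ 2 * (hubGraph f c).edgeFinset.card := by
    have h := card_mul_pred_le_two_mul_card_edgeFinset (hubGraph f c)
      (Finset.Iic (⟨k, by omega⟩ : Fin (3 * k))) (by
        intro u hu v hv huv
        simp only [Finset.coe_Iic, Set.mem_Iic, Fin.le_def] at hu hv
        refine ⟨huv, .inr (.inr ?_)⟩
        simp only [hf]
        omega)
    simpa using h
  have hE : 0 < (hubGraph f c).edgeFinset.card := by
    have : 0 < (k + 1) * k := by positivity
    omega
  refine ⟨3 * k, by omega, hubGraph f c, levelGraph f, hG, hS, by convert hE, ?_⟩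
  have hAPD := le_APD (S := levelGraph f) hG
    (Finset.Iio (⟨k, by omega⟩ : Fin (3 * k))) (Finset.Ici (⟨2 * k, by omega⟩ : Fin (3 * k)))
    (by
      rw [Finset.disjoint_left]
      intro u hu hv
      simp only [Finset.mem_Iio, Finset.mem_Ici, Fin.lt_def, Fin.le_def] at hu hv
      omega) k
    (fun u _ v _ => hubGraph_dist_le_two f c u v) (by
      intro u hu v hv
      simp only [Finset.mem_Iio, Finset.mem_Ici, Fin.lt_def, Fin.le_def] at hu hv
      have h := levelGraph_le_add_dist f hS u v
      have hu' : f u = 0 := by simp only [hf]; omega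
      have hv' : k ≤ f v := by simp only [hf]; omega
      omega)
  have hND := ND_hubGraph_levelGraph_le f c hS
  have hkR : (0 : ℝ) < k := by exact_mod_cast hk0
  have hlower : (k : ℝ) / 18 ≤ APD (hubGraph f c) (levelGraph f) := by
    refine le_trans ?_ hAPD
    simp only [Fin.card_Iio, Fin.card_Ici, Fintype.card_fin]
    rw [show 3 * k - 2 * k = k by omega, Nat.cast_choose_two]
    push_cast
    have : (0 : ℝ) < 3 * k - 1 := by
      have : (1 : ℝ) ≤ k := by exact_mod_cast hk0
      linarith
    rw [div_mul_eq_mul_div, le_div_iff₀ (by positivity)]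
    nlinarith [pow_pos hkR 2]
  have hupper : ND (hubGraph f c) (levelGraph f) ≤ 27 := by
    refine hND.trans ?_
    simp only [Fintype.card_fin]
    push_cast
    have hER : ((k : ℝ) + 1) * k ≤ 2 * ((hubGraph f c).edgeFinset.card : ℝ) := by
      exact_mod_cast hedge
    rw [div_mul_eq_mul_div, div_le_iff₀ (by exact_mod_cast hE)]
    nlinarith
  calc M * ND (hubGraph f c) (levelGraph f) ≤ M * 27 := by gcongr
    _ ≤ k / 18 := by linarith
    _ ≤ _ := hlower
end

section
/- For every real M > 0 there exist a finite vertex set V with n = |V| ≥ 2, a connected simple graph G on V with at least one edge, and a connected spanning subgraph S ≤ G such that ND(G, S) ≥ M · APD(G, S); that is, the average neighborhood distortion can be arbitrarily larger than the average all-pairs distortion. -/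
open Finset SimpleGraph Real

attribute [local instance] Classical.propDecidable

/-- The parent of `v` in the broom: the vertices below `k` form a path ending at `0`,
and all other vertices are leaves attached to `0`. -/
def broomParent (k v : ℕ) : ℕ := if v < k then v - 1 else 0

/-- The depth of `v` in the broom rooted at `0`. -/
def broomDepth (k v : ℕ) : ℕ := if v < k then v else 1

/-- The tree consisting of a path on the vertices below `k`, with all other vertices attached
as leaves to `0`. -/
def broom (n k : ℕ) : SimpleGraph (Fin n) where
  Adj u v := u ≠ v ∧ (broomParent k u = v ∨ broomParent k v = u)
  symm := ⟨fun _ _ h => ⟨h.1.symm, h.2.symm⟩⟩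
  loopless := ⟨fun _ h => h.1 rfl⟩

/-- A clique on the vertices below `k`, with all other vertices attached as leaves to `0`. -/
def leafyClique (n k : ℕ) : SimpleGraph (Fin n) where
  Adj u v := u ≠ v ∧ (((u : ℕ) < k ∧ (v : ℕ) < k) ∨ (u : ℕ) = 0 ∨ (v : ℕ) = 0)
  symm := ⟨fun _ _ h => ⟨h.1.symm, by tauto⟩⟩
  loopless := ⟨fun _ h => h.1 rfl⟩

theorem broom_le_leafyClique (n k : ℕ) : broom n k ≤ leafyClique n k := by
  rintro u v ⟨hne, h⟩
  refine ⟨hne, ?_⟩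
  have hne' : (u : ℕ) ≠ v := fun e => hne (Fin.ext e)
  unfold broomParent at h
  split_ifs at h <;> omega

theorem exists_broom_walk_to_root {n k : ℕ} (hn : 0 < n) (v : Fin n) :
    ∃ w : (broom n k).Walk v ⟨0, hn⟩, w.length ≤ broomDepth k v := by
  obtain ⟨v, hv⟩ := v
  induction v with
  | zero => exact ⟨Walk.nil, by simp⟩
  | succ v ih =>
    by_cases hvk : v + 1 < k
    · obtain ⟨w, hw⟩ := ih (by omega)
      have hadj : (broom n k).Adj ⟨v + 1, hv⟩ ⟨v, by omega⟩ :=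
        ⟨by simp, Or.inl (by simp [broomParent, hvk])⟩
      refine ⟨Walk.cons hadj w, ?_⟩
      simp only [broomDepth, Nat.lt_of_succ_lt hvk, if_true] at hw
      simpa [broomDepth, hvk] using hw
    · have hadj : (broom n k).Adj ⟨v + 1, hv⟩ ⟨0, hn⟩ :=
        ⟨by simp, Or.inl (by simp [broomParent, hvk])⟩
      exact ⟨Walk.cons hadj Walk.nil, by simp [broomDepth, hvk]⟩

theorem broom_connected {n k : ℕ} (hn : 0 < n) : (broom n k).Connected := by
  have hroot (v : Fin n) : (broom n k).Reachable v ⟨0, hn⟩ :=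
    (exists_broom_walk_to_root hn v).choose.reachable
  have : Nonempty (Fin n) := ⟨⟨0, hn⟩⟩
  exact ⟨fun u v => (hroot u).trans (hroot v).symm⟩

theorem broom_dist_le {n k : ℕ} (hn : 0 < n) (u v : Fin n) :
    (broom n k).dist u v ≤ broomDepth k u + broomDepth k v := by
  obtain ⟨p, hp⟩ := exists_broom_walk_to_root (k := k) hn u
  obtain ⟨q, hq⟩ := exists_broom_walk_to_root (k := k) hn v
  have h := dist_le (p.append q.reverse)
  rw [Walk.length_append, Walk.length_reverse] at h
  omega

theorem broomDepth_le_add_one_of_adj {n k : ℕ} {u v : Fin n} (h : (broom n k).Adj u v) :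
    broomDepth k v ≤ broomDepth k u + 1 := by
  obtain ⟨-, h⟩ := h
  unfold broomParent at h
  unfold broomDepth
  split_ifs at h ⊢ <;> omega

theorem broomDepth_le_add_length {n k : ℕ} {u v : Fin n} (w : (broom n k).Walk u v) :
    broomDepth k v ≤ broomDepth k u + w.length := by
  induction w with
  | nil => simp
  | cons h w ih =>
    have := broomDepth_le_add_one_of_adj h
    rw [Walk.length_cons]
    omega

theorem broomDepth_le_add_dist {n k : ℕ} (hn : 0 < n) (u v : Fin n) :
    broomDepth k v ≤ broomDepth k u + (broom n k).dist u v := by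
  obtain ⟨w, hw⟩ := (broom_connected hn).exists_walk_length_eq_dist u v
  exact hw ▸ broomDepth_le_add_length w

theorem sum_fin_indicator_Ico {n a b : ℕ} (hb : b ≤ n) :
    ∑ i : Fin n, (if a ≤ (i : ℕ) ∧ (i : ℕ) < b then (1 : ℝ) else 0) = ((b - a : ℕ) : ℝ) := by
  rw [Fin.sum_univ_eq_sum_range (fun i => if a ≤ i ∧ i < b then (1 : ℝ) else 0) n,
    Finset.sum_boole]
  congr 1
  rw [← Nat.card_Ico]
  congr 1
  ext i
  simp only [Finset.mem_filter, Finset.mem_range, Finset.mem_Ico]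
  omega

theorem sum_broomDepth_le {n k : ℕ} (hk : k ≤ n) :
    ∑ v : Fin n, (broomDepth k v : ℝ) ≤ n + k * k := by
  have hle (v : Fin n) : (broomDepth k v : ℝ) ≤
      1 + k * (if 0 ≤ (v : ℕ) ∧ (v : ℕ) < k then (1 : ℝ) else 0) := by
    by_cases hv : (v : ℕ) < k
    · have : (v : ℝ) ≤ k := by exact_mod_cast hv.le
      simp only [broomDepth, hv, if_true, Nat.zero_le, and_self]
      linarith
    · simp [broomDepth, hv]
  calc _ ≤ _ := Finset.sum_le_sum fun v _ => hle v
    _ = n + k * k := by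
      rw [Finset.sum_add_distrib, ← Finset.mul_sum, sum_fin_indicator_Ico hk]
      simp

theorem APD_le_eight {n k : ℕ} (hn : 2 ≤ n) (hk : 0 < k) (hkn : k * k ≤ n) :
    APD (leafyClique n k) (broom n k) ≤ 8 := by
  have hn0 : 0 < n := by omega
  have hkn' : k ≤ n := le_trans (Nat.le_mul_of_pos_left k hk) hkn
  have hterm (u v : Fin n) :
      (if u ≠ v then ((broom n k).dist u v : ℝ) / ((leafyClique n k).dist u v : ℝ) else 0) ≤
        broomDepth k u + broomDepth k v := by
    split_ifs with h
    · have h1 : ((broom n k).dist u v : ℝ) ≤ broomDepth k u + broomDepth k v := by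
        exact_mod_cast broom_dist_le hn0 u v
      have hconn := (broom_connected hn0).mono (broom_le_leafyClique n k)
      have h2 : (1 : ℝ) ≤ (leafyClique n k).dist u v := by
        exact_mod_cast hconn.pos_dist_of_ne h
      exact (div_le_self (Nat.cast_nonneg _) h2).trans h1
    · positivity
  have hsum := Finset.sum_le_sum fun u (_ : u ∈ univ) =>
    Finset.sum_le_sum fun v (_ : v ∈ univ) => hterm u v
  simp only [Finset.sum_add_distrib, Finset.sum_const, Finset.card_univ, Fintype.card_fin,
    nsmul_eq_mul, ← Finset.mul_sum] at hsum
  have hdepth := sum_broomDepth_le hkn'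
  have hkR : (k : ℝ) * k ≤ n := by exact_mod_cast hkn
  have hnR : (2 : ℝ) ≤ n := by exact_mod_cast hn
  unfold APD
  rw [Fintype.card_fin, Nat.cast_choose_two, one_div_mul_eq_div, div_le_iff₀ (by nlinarith)]
  nlinarith

theorem card_edgeFinset_leafyClique_le {n k : ℕ} (hn : 0 < n) (hkn : k ≤ n) :
    (leafyClique n k).edgeFinset.card ≤ k * k + n := by
  let f : Fin k × Fin k ⊕ Fin n → Sym2 (Fin n) :=
    Sum.elim (fun p => s(p.1.castLE hkn, p.2.castLE hkn)) (fun v => s(⟨0, hn⟩, v))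
  have hsub : (leafyClique n k).edgeFinset ⊆ univ.image f := by
    intro e he
    induction e with
    | _ u v =>
      rw [mem_edgeFinset, mem_edgeSet] at he
      simp only [Finset.mem_image, Finset.mem_univ, true_and]
      obtain ⟨-, ⟨hu, hv⟩ | hu | hv⟩ := he
      · exact ⟨Sum.inl (⟨u, hu⟩, ⟨v, hv⟩), rfl⟩
      · exact ⟨Sum.inr v, by rw [show u = ⟨0, hn⟩ from Fin.ext hu]; rfl⟩
      · exact ⟨Sum.inr u, by rw [show v = ⟨0, hn⟩ from Fin.ext hv]; exact Sym2.eq_swap⟩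
  calc _ ≤ _ := Finset.card_le_card hsub
    _ ≤ _ := Finset.card_image_le
    _ = k * k + n := by simp

theorem card_edgeFinset_leafyClique_pos {n k : ℕ} (hn : 2 ≤ n) :
    0 < (leafyClique n k).edgeFinset.card := by
  refine Finset.card_pos.mpr ⟨s(⟨0, by omega⟩, ⟨1, by omega⟩), ?_⟩
  rw [mem_edgeFinset, mem_edgeSet]
  exact ⟨by simp, Or.inr (Or.inl rfl)⟩

theorem pow_three_le_sum_dist_broom {n m : ℕ} (hm : 0 < m) (hn : 3 * m ≤ n) :
    (m : ℝ) ^ 3 ≤ ∑ u : Fin n, ∑ v : Fin n,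
      if (leafyClique n (3 * m)).Adj u v then ((broom n (3 * m)).dist u v : ℝ) else 0 := by
  have hterm (u v : Fin n) :
      m * ((if 0 ≤ (u : ℕ) ∧ (u : ℕ) < m then (1 : ℝ) else 0) *
        (if 2 * m ≤ (v : ℕ) ∧ (v : ℕ) < 3 * m then (1 : ℝ) else 0)) ≤
      if (leafyClique n (3 * m)).Adj u v then ((broom n (3 * m)).dist u v : ℝ) else 0 := by
    by_cases hu : 0 ≤ (u : ℕ) ∧ (u : ℕ) < m
    · by_cases hv : 2 * m ≤ (v : ℕ) ∧ (v : ℕ) < 3 * m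
      · have hadj : (leafyClique n (3 * m)).Adj u v :=
          ⟨fun h => by rw [h] at hu; omega, Or.inl ⟨by omega, by omega⟩⟩
        have hdist := broomDepth_le_add_dist (k := 3 * m) (by omega) u v
        rw [broomDepth, broomDepth, if_pos hv.2, if_pos (by omega)] at hdist
        rw [if_pos hu, if_pos hv, if_pos hadj, mul_one, mul_one]
        exact_mod_cast (by omega : m ≤ (broom n (3 * m)).dist u v)
      · rw [if_neg hv, mul_zero, mul_zero]
        positivity
    · rw [if_neg hu, zero_mul, mul_zero]
      positivity
  have hsum := Finset.sum_le_sum fun u (_ : u ∈ univ) =>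
    Finset.sum_le_sum fun v (_ : v ∈ univ) => hterm u v
  simp only [← Finset.mul_sum] at hsum
  rw [← Finset.sum_mul, sum_fin_indicator_Ico (by omega), sum_fin_indicator_Ico hn,
    show m - 0 = m by omega, show 3 * m - 2 * m = m by omega] at hsum
  calc (m : ℝ) ^ 3 = m * (m * m) := by ring
    _ ≤ _ := hsum

theorem div_le_ND {m : ℕ} (hm : 0 < m) :
    (m : ℝ) / 42 ≤ ND (leafyClique (9 * m ^ 2 + 3 * m) (3 * m))
      (broom (9 * m ^ 2 + 3 * m) (3 * m)) := by
  have hsum := pow_three_le_sum_dist_broom (n := 9 * m ^ 2 + 3 * m) hm (by omega)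
  have hcard := card_edgeFinset_leafyClique_le (n := 9 * m ^ 2 + 3 * m) (k := 3 * m)
    (by positivity) (by omega)
  have hpos := card_edgeFinset_leafyClique_pos (n := 9 * m ^ 2 + 3 * m) (k := 3 * m) (by nlinarith)
  have hcard' : (leafyClique (9 * m ^ 2 + 3 * m) (3 * m)).edgeFinset.card ≤ 21 * m ^ 2 := by
    nlinarith
  have hcardR : ((leafyClique (9 * m ^ 2 + 3 * m) (3 * m)).edgeFinset.card : ℝ) ≤ 21 * m ^ 2 := by
    exact_mod_cast hcard'
  unfold ND
  rw [one_div_mul_eq_div, le_div_iff₀ (by exact_mod_cast hpos)]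
  calc _ ≤ (m : ℝ) / 42 * (21 * m ^ 2) := by gcongr
    _ = 1 / 2 * (m : ℝ) ^ 3 := by ring
    _ ≤ _ := by gcongr

theorem stmt_14 (M : ℝ) (hM : 0 < M) :
    ∃ n : ℕ, 2 ≤ n ∧
      ∃ G S : SimpleGraph (Fin n), G.Connected ∧ S.Connected ∧ S ≤ G ∧
        0 < G.edgeFinset.card ∧ ND G S ≥ M * APD G S := by
  obtain ⟨m, hm⟩ := exists_nat_gt (336 * M)
  have hm0 : 0 < m := by
    have : (0 : ℝ) < m := by linarith
    exact_mod_cast this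
  have hn : 2 ≤ 9 * m ^ 2 + 3 * m := by nlinarith
  have hconn := broom_connected (n := 9 * m ^ 2 + 3 * m) (k := 3 * m) (by omega)
  have hle := broom_le_leafyClique (9 * m ^ 2 + 3 * m) (3 * m)
  refine ⟨9 * m ^ 2 + 3 * m, hn, leafyClique _ (3 * m), broom _ (3 * m), hconn.mono hle, hconn,
    hle, card_edgeFinset_leafyClique_pos hn, ?_⟩
  have hAPD := APD_le_eight (n := 9 * m ^ 2 + 3 * m) (k := 3 * m) hn (by omega) (by nlinarith)
  calc M * APD _ _ ≤ M * 8 := by gcongr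
    _ ≤ m / 42 := by linarith
    _ ≤ _ := div_le_ND hm0
end

section
/- Let (T, r) be a rooted tree on a finite vertex set V and let Δ ≥ 1 be a natural number. In (T, r), define the number of children of a vertex v as deg_T(v) if v = r and deg_T(v) − 1 otherwise; call v internal if it has at least one child and a leaf otherwise. Suppose every vertex of T has either exactly Δ children or no children. Then ∑_{v internal} (Δ+1)^{−(d_T(r,v)+1)} + ∑_{v leaf} (Δ+1)^{−d_T(r,v)} = 1. -/
open Finset SimpleGraph Real

attribute [local instance] Classical.propDecidable

/-- In a tree rooted at `r`, every vertex other than `r` has exactly one parent. -/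
theorem SimpleGraph.IsTree.existsUnique_parent {V : Type*} {T : SimpleGraph V} (hT : T.IsTree)
    {r v : V} (hv : v ≠ r) : ∃! u, T.Adj u v ∧ T.dist r v = T.dist r u + 1 := by
  have path_concat : ∀ u (h : T.Adj u v), T.dist r v = T.dist r u + 1 →
      ∃ p : T.Walk r v, p.IsPath ∧ p.penultimate = u := by
    intro u h hd
    obtain ⟨p, hp⟩ := hT.connected.exists_walk_length_eq_dist r u
    exact ⟨p.concat h, Walk.isPath_of_length_eq_dist _ (by simp [hp, hd]), by simp⟩
  obtain ⟨p, hp⟩ := hT.connected.exists_walk_length_eq_dist r v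
  have hnil : ¬ p.Nil := Walk.not_nil_of_ne hv.symm
  have hadj := p.adj_penultimate hnil
  have hle : T.dist r p.penultimate + 1 ≤ T.dist r v := by
    have h1 := dist_le p.dropLast
    have h2 : p.dropLast.length + 1 = p.length := p.length_dropLast_add_one hnil
    omega
  refine ⟨p.penultimate, ⟨hadj, ?_⟩, ?_⟩
  · have := hT.dist_eq_dist_add_one_of_adj r hadj
    omega
  · rintro u ⟨hu, hd⟩
    obtain ⟨q, hq, rfl⟩ := path_concat u hu hd
    rw [(hT.existsUnique_path r v).unique hq (p.isPath_of_length_eq_dist hp)]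

/-- In a tree rooted at `r`, the neighbours of `v` further away from `r` than `v` are all the
neighbours of `v` if `v = r`, and all but one otherwise. -/
theorem SimpleGraph.IsTree.card_filter_adj_dist {V : Type*} [Fintype V] {T : SimpleGraph V}
    (hT : T.IsTree) (r v : V) [Fintype (T.neighborSet v)] :
    #{w | T.Adj v w ∧ T.dist r w = T.dist r v + 1} =
      if v = r then T.degree v else T.degree v - 1 := by
  have hsplit : T.degree v = #{w | T.Adj v w ∧ T.dist r w = T.dist r v + 1} +
      #{w | T.Adj w v ∧ T.dist r v = T.dist r w + 1} := by
    rw [← card_neighborFinset_eq_degree, ← Finset.card_union_of_disjoint]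
    · congr 1
      ext w
      simp only [mem_neighborFinset, Finset.mem_union, Finset.mem_filter, Finset.mem_univ, true_and]
      constructor
      · intro h
        rcases hT.dist_eq_dist_add_one_of_adj r h with h' | h'
        · exact .inr ⟨h.symm, h'⟩
        · exact .inl ⟨h, h'⟩
      · rintro (h | h)
        exacts [h.1, h.1.symm]
    · rw [Finset.disjoint_filter]
      omega
  split_ifs with h
  · subst h
    simpa using hsplit.symm
  · have hone : #{w | T.Adj w v ∧ T.dist r v = T.dist r w + 1} = 1 := by
      obtain ⟨u, hu, huniq⟩ := hT.existsUnique_parent h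
      rw [Finset.card_eq_one]
      refine ⟨u, ?_⟩
      ext w
      simp only [Finset.mem_filter, Finset.mem_univ, true_and, Finset.mem_singleton]
      exact ⟨huniq w, fun hw => hw ▸ hu⟩
    omega

/-- Summing over all pairs of a parent and its child in a tree rooted at `r` amounts to summing
over all vertices other than `r`. -/
theorem SimpleGraph.IsTree.sum_sum_children {V M : Type*} [Fintype V] [AddCommMonoid M]
    {T : SimpleGraph V} (hT : T.IsTree) (r : V) (f : V → M) :
    ∑ v, ∑ w with T.Adj v w ∧ T.dist r w = T.dist r v + 1, f w = ∑ w with w ≠ r, f w := by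
  simp_rw [Finset.sum_filter]
  rw [Finset.sum_comm]
  refine Finset.sum_congr rfl fun w _ => ?_
  split_ifs with hw
  · obtain ⟨u, hu, huniq⟩ := hT.existsUnique_parent hw
    rw [Finset.sum_eq_single u (fun v _ hv => if_neg fun h => hv (huniq v h)) (by simp), if_pos hu]
  · refine Finset.sum_eq_zero fun v _ => if_neg ?_
    rintro ⟨-, h⟩
    rw [not_not] at hw
    simp [hw] at h

theorem stmt_15 {V : Type} [Fintype V] [DecidableEq V]
    (T : SimpleGraph V) (hT : T.IsTree) (r : V) (Δ : ℕ) (hΔ : 1 ≤ Δ)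
    (children : V → ℕ)
    (hchildren : ∀ v, children v = if v = r then T.degree v else T.degree v - 1)
    (hfull : ∀ v, children v = Δ ∨ children v = 0) :
    ∑ v ∈ Finset.univ.filter (fun v => 1 ≤ children v),
        ((Δ : ℝ) + 1) ^ (-((T.dist r v : ℤ) + 1))
      + ∑ v ∈ Finset.univ.filter (fun v => children v = 0),
        ((Δ : ℝ) + 1) ^ (-(T.dist r v : ℤ)) = 1 := by
  have hpos : (Δ : ℝ) + 1 ≠ 0 := by positivity
  have hcard (v : V) : #{w | T.Adj v w ∧ T.dist r w = T.dist r v + 1} = children v := by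
    rw [hchildren, hT.card_filter_adj_dist r v]
    congr
  have hsucc (v : V) : ∑ w with T.Adj v w ∧ T.dist r w = T.dist r v + 1,
      ((Δ : ℝ) + 1) ^ (-(T.dist r w : ℤ)) =
        children v * ((Δ : ℝ) + 1) ^ (-((T.dist r v : ℤ) + 1)) := by
    rw [← hcard, ← nsmul_eq_mul, ← Finset.sum_const]
    refine Finset.sum_congr rfl fun w hw => ?_
    rw [(Finset.mem_filter.mp hw).2.2]
    push_cast
    rfl
  have hterm (v : V) : (if 1 ≤ children v then ((Δ : ℝ) + 1) ^ (-((T.dist r v : ℤ) + 1)) else 0) +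
      (if children v = 0 then ((Δ : ℝ) + 1) ^ (-(T.dist r v : ℤ)) else 0) =
        ((Δ : ℝ) + 1) ^ (-(T.dist r v : ℤ)) -
          children v * ((Δ : ℝ) + 1) ^ (-((T.dist r v : ℤ) + 1)) := by
    have hstep : ((Δ : ℝ) + 1) ^ (-(T.dist r v : ℤ)) =
        ((Δ : ℝ) + 1) ^ (-((T.dist r v : ℤ) + 1)) * (Δ + 1) := by
      rw [← zpow_add_one₀ hpos]
      congr 1
      ring
    rcases hfull v with h | h
    · rw [h, if_pos hΔ, if_neg (by omega), hstep]
      ring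
    · simp [h]
  have hroot := Finset.sum_filter_add_sum_filter_not Finset.univ (fun w => w ≠ r)
    fun w => ((Δ : ℝ) + 1) ^ (-(T.dist r w : ℤ))
  have hsum := hT.sum_sum_children r fun w => ((Δ : ℝ) + 1) ^ (-(T.dist r w : ℤ))
  simp only [not_not, Finset.filter_eq', Finset.mem_univ, if_true, Finset.sum_singleton,
    SimpleGraph.dist_self, Nat.cast_zero, neg_zero, zpow_zero] at hroot
  rw [Finset.sum_filter, Finset.sum_filter, ← Finset.sum_add_distrib,
    Finset.sum_congr rfl fun v _ => hterm v, Finset.sum_sub_distrib,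
    ← Finset.sum_congr rfl fun v _ => hsucc v, hsum, ← hroot]
  convert add_sub_cancel_left _ _
end
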